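/- arXiv:2603.05098 — 7 statements merged into one kernel-verified Lean document; each statement's English description precedes it below -/
import Mathlib

section
/- Assume α ∈ ℓ^{1,1}(ℤ). For every λ ∈ ℝ∖{0}: the sequence (P_j(λ)⁻¹)_{j≥1} converges in the space of 2×2 complex matrices as j → +∞ to a matrix of determinant 1 (hence invertible), denoted P_{+∞}(λ)⁻¹, and the sequence (P_j(λ)⁻¹)_{j≤−1} converges as j → −∞ to a matrix of determinant 1, denoted P_{−∞}(λ)⁻¹. Moreover the maps λ ↦ P_{+∞}(λ)⁻¹ and λ ↦ P_{−∞}(λ)⁻¹ are continuously differentiable on ℝ∖{0}. -/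
open Complex Filter Matrix

/-- The nilpotent matrix `N_j(λ)` from the paper. -/
noncomputable def Nmat (j : ℤ) (lam : ℂ) : Matrix (Fin 2) (Fin 2) ℂ :=
  if lam = 0 then
    ((j.sign : ℤ) : ℂ) • !![-(j : ℂ), -((j : ℂ)) ^ 2; 1, (j : ℂ)]
  else
    (((j.sign : ℤ) : ℂ) / (2 * Complex.I * lam)) •
      !![1, Complex.exp (-(2 * Complex.I * lam * (j : ℂ)));
         -Complex.exp (2 * Complex.I * lam * (j : ℂ)), -1]

/-- `M_j(λ) = I₂ + α_j N_j(λ)`. -/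
noncomputable def Mmat (α : ℤ → ℝ) (j : ℤ) (lam : ℂ) : Matrix (Fin 2) (Fin 2) ℂ :=
  1 + (α j : ℂ) • Nmat j lam

/-- `Ppos α lam n = M_n(λ) ⋯ M_1(λ)`, i.e. `P_j(λ)` for `j = n ≥ 1` (with `Ppos 0 = I₂`). -/
noncomputable def Ppos (α : ℤ → ℝ) (lam : ℂ) : ℕ → Matrix (Fin 2) (Fin 2) ℂ
  | 0 => 1
  | n + 1 => Mmat α ((n : ℤ) + 1) lam * Ppos α lam n

/-- `Pneg α lam n = M_{-n}(λ) ⋯ M_{-1}(λ)`, i.e. `P_j(λ)` for `j = -n ≤ -1` (with `Pneg 0 = I₂`). -/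
noncomputable def Pneg (α : ℤ → ℝ) (lam : ℂ) : ℕ → Matrix (Fin 2) (Fin 2) ℂ
  | 0 => 1
  | n + 1 => Mmat α (-((n : ℤ) + 1)) lam * Pneg α lam n

open scoped Topology

section InfiniteProduct

variable {A : Type*} [NormedRing A]

/-- The derivatives of the partial products `Q n` satisfying `Q (n + 1) = Q n * (1 + F n)`,
where `F' n` is the derivative of `F n`. -/
def partialProdDeriv (Q F F' : ℕ → ℝ → A) : ℕ → ℝ → A
  | 0, _ => 0
  | n + 1, x => partialProdDeriv Q F F' n x +
      (partialProdDeriv Q F F' n x * F n x + Q n x * F' n x)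

variable {Q F F' : ℕ → ℝ → A} {s : Set ℝ} {u v : ℕ → ℝ}

theorem norm_partialProd_le [NormOneClass A] (hQ0 : ∀ x ∈ s, Q 0 x = 1)
    (hQ : ∀ n, ∀ x ∈ s, Q (n + 1) x = Q n x * (1 + F n x))
    (hF : ∀ n, ∀ x ∈ s, ‖F n x‖ ≤ u n) (n : ℕ) {x : ℝ} (hx : x ∈ s) :
    ‖Q n x‖ ≤ ∏ k ∈ Finset.range n, (1 + u k) := by
  induction n with
  | zero => simp [hQ0 x hx]
  | succ n ih =>
    rw [hQ n x hx, Finset.prod_range_succ]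
    have h1 : ‖1 + F n x‖ ≤ 1 + u n :=
      (norm_add_le _ _).trans (by rw [norm_one]; linarith [hF n x hx])
    exact (norm_mul_le _ _).trans
      (mul_le_mul ih h1 (norm_nonneg _) ((norm_nonneg _).trans ih))

theorem norm_partialProdDeriv_le [NormOneClass A] (hQ0 : ∀ x ∈ s, Q 0 x = 1)
    (hQ : ∀ n, ∀ x ∈ s, Q (n + 1) x = Q n x * (1 + F n x))
    (hF : ∀ n, ∀ x ∈ s, ‖F n x‖ ≤ u n) (hF' : ∀ n, ∀ x ∈ s, ‖F' n x‖ ≤ v n)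
    (n : ℕ) {x : ℝ} (hx : x ∈ s) :
    ‖partialProdDeriv Q F F' n x‖ ≤
      (∏ k ∈ Finset.range n, (1 + u k)) * ∑ k ∈ Finset.range n, v k := by
  induction n with
  | zero => simp [partialProdDeriv]
  | succ n ih =>
    rw [Finset.prod_range_succ, Finset.sum_range_succ]
    have hE := norm_partialProd_le hQ0 hQ hF n hx
    set E := ∏ k ∈ Finset.range n, (1 + u k)
    set S := ∑ k ∈ Finset.range n, v k
    have hu := hF n x hx
    have hv := hF' n x hx
    have hE0 : 0 ≤ E := (norm_nonneg _).trans hE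
    have hu0 : 0 ≤ u n := (norm_nonneg _).trans hu
    have hv0 : 0 ≤ v n := (norm_nonneg _).trans hv
    have h1 : ‖partialProdDeriv Q F F' n x * F n x‖ ≤ E * S * u n :=
      (norm_mul_le _ _).trans (mul_le_mul ih hu (norm_nonneg _) ((norm_nonneg _).trans ih))
    have h2 : ‖Q n x * F' n x‖ ≤ E * v n :=
      (norm_mul_le _ _).trans (mul_le_mul hE hv (norm_nonneg _) hE0)
    calc ‖partialProdDeriv Q F F' (n + 1) x‖
        ≤ E * S + (E * S * u n + E * v n) :=
          (norm_add_le _ _).trans (add_le_add ih ((norm_add_le _ _).trans (add_le_add h1 h2)))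
      _ ≤ E * (1 + u n) * (S + v n) := by
          nlinarith [mul_nonneg (mul_nonneg hE0 hu0) hv0]

variable [NormedAlgebra ℝ A]

theorem hasDerivAt_partialProd (hs : IsOpen s) (hQ0 : ∀ x ∈ s, Q 0 x = 1)
    (hQ : ∀ n, ∀ x ∈ s, Q (n + 1) x = Q n x * (1 + F n x))
    (hFF' : ∀ n, ∀ x ∈ s, HasDerivAt (F n) (F' n x) x) (n : ℕ) {x : ℝ} (hx : x ∈ s) :
    HasDerivAt (Q n) (partialProdDeriv Q F F' n x) x := by
  induction n with
  | zero =>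
    refine (hasDerivAt_const x (1 : A)).congr_of_eventuallyEq ?_
    filter_upwards [hs.mem_nhds hx] with y hy using hQ0 y hy
  | succ n ih =>
    have h := ih.mul ((hFF' n x hx).const_add 1)
    have h2 : HasDerivAt (Q (n + 1))
        (partialProdDeriv Q F F' n x * (1 + F n x) + Q n x * F' n x) x := by
      refine h.congr_of_eventuallyEq ?_
      filter_upwards [hs.mem_nhds hx] with y hy using hQ n y hy
    convert h2 using 1
    simp only [partialProdDeriv]
    noncomm_ring

/-- An infinite product `∏ (1 + F n)` in a Banach algebra whose factors are continuously
differentiable on an open set, with `F n` and its derivative summably bounded there, converges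
to a continuously differentiable function. -/
theorem exists_tendsto_partialProd_contDiffOn [NormOneClass A] [CompleteSpace A]
    (hs : IsOpen s) (hQ0 : ∀ x ∈ s, Q 0 x = 1)
    (hQ : ∀ n, ∀ x ∈ s, Q (n + 1) x = Q n x * (1 + F n x))
    (hFF' : ∀ n, ∀ x ∈ s, HasDerivAt (F n) (F' n x) x)
    (hF'c : ∀ n, ContinuousOn (F' n) s)
    (hF : ∀ n, ∀ x ∈ s, ‖F n x‖ ≤ u n) (hF' : ∀ n, ∀ x ∈ s, ‖F' n x‖ ≤ v n)
    (hu : Summable u) (hv : Summable v) :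
    ∃ L : ℝ → A, (∀ x ∈ s, Tendsto (fun n => Q n x) atTop (𝓝 (L x))) ∧ ContDiffOn ℝ 1 L s := by
  rcases s.eq_empty_or_nonempty with rfl | ⟨x₀, hx₀⟩
  · exact ⟨0, by simp, contDiffOn_empty⟩
  have hu0 n : 0 ≤ u n := (norm_nonneg _).trans (hF n x₀ hx₀)
  have hv0 n : 0 ≤ v n := (norm_nonneg _).trans (hF' n x₀ hx₀)
  set C := Real.exp (∑' n, u n)
  set D := ∑' n, v n
  have hC n : ∏ k ∈ Finset.range n, (1 + u k) ≤ C :=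
    (Real.prod_one_add_le_exp_sum _ fun k => hu0 k).trans
      (Real.exp_le_exp.2 (hu.sum_le_tsum _ fun k _ => hu0 k))
  have hD n : ∑ k ∈ Finset.range n, v k ≤ D := hv.sum_le_tsum _ fun k _ => hv0 k
  have hC0 : 0 ≤ C := (Real.exp_pos _).le
  have hD0 : 0 ≤ D := tsum_nonneg hv0
  have hQC n x (hx : x ∈ s) : ‖Q n x‖ ≤ C := (norm_partialProd_le hQ0 hQ hF n hx).trans (hC n)
  have hQD n x (hx : x ∈ s) : ‖partialProdDeriv Q F F' n x‖ ≤ C * D :=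
    (norm_partialProdDeriv_le hQ0 hQ hF hF' n hx).trans
      (mul_le_mul (hC n) (hD n) (Finset.sum_nonneg fun k _ => hv0 k) hC0)
  have hder n x (hx : x ∈ s) := hasDerivAt_partialProd hs hQ0 hQ hFF' n hx
  have hsum n x (hx : x ∈ s) : Q n x = 1 + ∑ k ∈ Finset.range n, Q k x * F k x := by
    induction n with
    | zero => simp [hQ0 x hx]
    | succ n ih => rw [hQ n x hx, Finset.sum_range_succ, ← add_assoc, ← ih, mul_add, mul_one]
  have hsum' n x : partialProdDeriv Q F F' n x = ∑ k ∈ Finset.range n,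
      (partialProdDeriv Q F F' k x * F k x + Q k x * F' k x) := by
    induction n with
    | zero => rfl
    | succ n ih => rw [Finset.sum_range_succ, ← ih]; rfl
  have hlim x (hx : x ∈ s) : Tendsto (fun n => Q n x) atTop (𝓝 (1 + ∑' k, Q k x * F k x)) := by
    have hS : Summable fun k => Q k x * F k x := by
      refine Summable.of_norm_bounded (hu.mul_left C) fun k => (norm_mul_le _ _).trans ?_
      exact mul_le_mul (hQC k x hx) (hF k x hx) (norm_nonneg _) hC0
    exact (hS.hasSum.tendsto_sum_nat.const_add 1).congr fun n => (hsum n x hx).symm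
  have hunif : TendstoUniformlyOn (partialProdDeriv Q F F')
      (fun x => ∑' k, (partialProdDeriv Q F F' k x * F k x + Q k x * F' k x)) atTop s := by
    have h := tendstoUniformlyOn_tsum_nat (s := s)
      (f := fun k x => partialProdDeriv Q F F' k x * F k x + Q k x * F' k x)
      ((hu.mul_left (C * D)).add (hv.mul_left C)) fun k x hx =>
        (norm_add_le _ _).trans <| add_le_add
          ((norm_mul_le _ _).trans
            (mul_le_mul (hQD k x hx) (hF k x hx) (norm_nonneg _) (mul_nonneg hC0 hD0)))
          ((norm_mul_le _ _).trans (mul_le_mul (hQC k x hx) (hF' k x hx) (norm_nonneg _) hC0))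
    exact h.congr (Eventually.of_forall fun n x _ => (hsum' n x).symm)
  have hdlim x (hx : x ∈ s) := hasDerivAt_of_tendstoUniformlyOn hs hunif
    (Eventually.of_forall hder) hlim hx
  have hcont n : ContinuousOn (partialProdDeriv Q F F' n) s := by
    induction n with
    | zero => exact continuousOn_const
    | succ n ih =>
      exact ih.add ((ih.mul fun x hx => (hFF' n x hx).continuousAt.continuousWithinAt).add
        (ContinuousOn.mul (fun x hx => (hder n x hx).continuousAt.continuousWithinAt) (hF'c n)))
  refine ⟨fun x => 1 + ∑' k, Q k x * F k x, hlim, ?_⟩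
  rw [show (1 : WithTop ℕ∞) = 0 + 1 from rfl, contDiffOn_succ_iff_deriv_of_isOpen hs]
  refine ⟨fun x hx => (hdlim x hx).differentiableAt.differentiableWithinAt, by simp, ?_⟩
  rw [contDiffOn_zero]
  exact (hunif.continuousOn (Frequently.of_forall hcont)).congr fun x hx => (hdlim x hx).deriv

end InfiniteProduct

section Transfer

theorem Nmat_of_ne_zero (j : ℤ) {lam : ℂ} (h : lam ≠ 0) :
    Nmat j lam = (((j.sign : ℤ) : ℂ) / (2 * Complex.I * lam)) •
      !![1, Complex.exp (-(2 * Complex.I * lam * (j : ℂ)));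
         -Complex.exp (2 * Complex.I * lam * (j : ℂ)), -1] := if_neg h

theorem Nmat_mul_self (j : ℤ) {lam : ℂ} (h : lam ≠ 0) : Nmat j lam * Nmat j lam = 0 := by
  rw [Nmat_of_ne_zero j h, smul_mul_smul_comm]
  convert smul_zero _
  have he : Complex.exp (-(2 * Complex.I * lam * (j : ℂ))) *
      Complex.exp (2 * Complex.I * lam * (j : ℂ)) = 1 := by
    rw [← Complex.exp_add]; simp
  ext i k
  fin_cases i <;> fin_cases k <;> simp [Matrix.mul_apply, Fin.sum_univ_two]
  · linear_combination -he
  · linear_combination -he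

theorem Mmat_inv (α : ℤ → ℝ) (j : ℤ) {lam : ℂ} (h : lam ≠ 0) :
    (Mmat α j lam)⁻¹ = 1 + -((α j : ℂ) • Nmat j lam) := by
  refine Matrix.inv_eq_right_inv ?_
  rw [Mmat, add_mul, one_mul, mul_add, mul_one, mul_neg, smul_mul_smul_comm, Nmat_mul_self j h]
  simp

theorem det_Mmat (α : ℤ → ℝ) (j : ℤ) {lam : ℂ} (h : lam ≠ 0) : (Mmat α j lam).det = 1 := by
  have he : Complex.exp (-(2 * Complex.I * lam * (j : ℂ))) *
      Complex.exp (2 * Complex.I * lam * (j : ℂ)) = 1 := by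
    rw [← Complex.exp_add]; simp
  rw [Mmat, Nmat_of_ne_zero j h, Matrix.det_fin_two]
  simp
  linear_combination ((α j : ℂ) * (((j.sign : ℤ) : ℂ) / (2 * Complex.I * lam))) ^ 2 * he

attribute [local instance] Matrix.linftyOpNormedRing Matrix.linftyOpNormedAlgebra

/-- The derivative of `λ ↦ N_j(λ)` along the real line, away from `0`. -/
noncomputable def NmatDeriv (j : ℤ) (x : ℝ) : Matrix (Fin 2) (Fin 2) ℂ :=
  (((j.sign : ℤ) : ℂ) / (2 * Complex.I * x)) •
      !![0, -(2 * Complex.I * j) * Complex.exp (-(2 * Complex.I * x * (j : ℂ)));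
         -(2 * Complex.I * j) * Complex.exp (2 * Complex.I * x * (j : ℂ)), 0] +
    (-((j.sign : ℤ) : ℂ) / (2 * Complex.I * x ^ 2)) •
      !![1, Complex.exp (-(2 * Complex.I * x * (j : ℂ)));
         -Complex.exp (2 * Complex.I * x * (j : ℂ)), -1]

theorem hasDerivAt_matrix {f : ℝ → Matrix (Fin 2) (Fin 2) ℂ} {f' : Matrix (Fin 2) (Fin 2) ℂ}
    {x : ℝ} (h : ∀ i k, HasDerivAt (fun y => f y i k) (f' i k) x) : HasDerivAt f f' x := by
  have h' : HasDerivAt (F := Fin 2 → Fin 2 → ℂ) f f' x :=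
    hasDerivAt_pi.2 fun i => hasDerivAt_pi.2 fun k => h i k
  exact h'

theorem hasDerivAt_Nmat (j : ℤ) {x : ℝ} (hx : x ≠ 0) :
    HasDerivAt (fun y : ℝ => Nmat j (y : ℂ)) (NmatDeriv j x) x := by
  have hxc : (x : ℂ) ≠ 0 := by exact_mod_cast hx
  have hid : HasDerivAt (fun y : ℝ => (y : ℂ)) 1 x := Complex.ofRealCLM.hasDerivAt
  have hc : HasDerivAt (fun y : ℝ => ((j.sign : ℤ) : ℂ) / (2 * Complex.I * y))
      (-((j.sign : ℤ) : ℂ) / (2 * Complex.I * x ^ 2)) x := by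
    have h := (hasDerivAt_const x ((j.sign : ℤ) : ℂ)).div (hid.const_mul (2 * Complex.I))
      (by simp [hxc])
    refine h.congr_deriv ?_
    field_simp
    ring
  have harg : HasDerivAt (fun y : ℝ => 2 * Complex.I * y * (j : ℂ)) (2 * Complex.I * j) x := by
    simpa using (hid.const_mul (2 * Complex.I)).mul_const (j : ℂ)
  have hp := harg.cexp
  have hm := harg.neg.cexp
  have key : HasDerivAt (fun y : ℝ => (((j.sign : ℤ) : ℂ) / (2 * Complex.I * y)) •
      !![1, Complex.exp (-(2 * Complex.I * y * (j : ℂ)));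
         -Complex.exp (2 * Complex.I * y * (j : ℂ)), -1]) (NmatDeriv j x) x := by
    refine hasDerivAt_matrix fun i k => ?_
    fin_cases i <;> fin_cases k
    · simpa [NmatDeriv] using hc
    · refine (hc.mul hm).congr_deriv ?_
      simp [NmatDeriv]; ring
    · refine (hc.mul hp.neg).congr_deriv ?_
      simp [NmatDeriv]; ring
    · refine (hc.mul_const (-1)).congr_deriv ?_ |>.congr_of_eventuallyEq ?_
      · simp [NmatDeriv]
      · exact Eventually.of_forall fun y => by simp
  refine key.congr_of_eventuallyEq ?_
  filter_upwards [isOpen_ne.mem_nhds hx] with y hy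
  exact Nmat_of_ne_zero j (by exact_mod_cast hy)

theorem continuousOn_NmatDeriv (j : ℤ) : ContinuousOn (NmatDeriv j) {x : ℝ | x ≠ 0} := by
  have h (x : ℝ) (hx : x ∈ {x : ℝ | x ≠ 0}) : (x : ℂ) ≠ 0 := by exact_mod_cast hx
  refine ContinuousOn.add (ContinuousOn.fun_smul ?_ (Continuous.continuousOn ?_))
    (ContinuousOn.fun_smul ?_ (Continuous.continuousOn ?_))
  · exact continuousOn_const.div (by fun_prop) fun x hx => by simp [h x hx]
  · refine continuous_matrix fun i k => ?_
    fin_cases i <;> fin_cases k <;> simp <;> fun_prop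
  · exact continuousOn_const.div (by fun_prop) fun x hx => by simp [h x hx]
  · refine continuous_matrix fun i k => ?_
    fin_cases i <;> fin_cases k <;> simp <;> fun_prop

theorem norm_matrix_two_le {B : Matrix (Fin 2) (Fin 2) ℂ} {c : ℝ} (h : ∀ i k, ‖B i k‖ ≤ c) :
    ‖B‖ ≤ 2 * c := by
  have hc : 0 ≤ c := (norm_nonneg _).trans (h 0 0)
  lift c to NNReal using hc
  rw [Matrix.linfty_opNorm_def, ← NNReal.coe_ofNat, ← NNReal.coe_mul, NNReal.coe_le_coe]
  refine Finset.sup_le fun i _ => ?_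
  rw [Fin.sum_univ_two, two_mul]
  exact add_le_add (h i 0) (h i 1)

theorem norm_exp_two_I_mul (x : ℝ) (j : ℤ) :
    ‖Complex.exp (2 * Complex.I * x * (j : ℂ))‖ = 1 := by
  rw [show 2 * Complex.I * x * (j : ℂ) = ((2 * x * j : ℝ) : ℂ) * Complex.I by push_cast; ring]
  exact Complex.norm_exp_ofReal_mul_I _

theorem norm_exp_neg_two_I_mul (x : ℝ) (j : ℤ) :
    ‖Complex.exp (-(2 * Complex.I * x * (j : ℂ)))‖ = 1 := by
  rw [Complex.exp_neg, norm_inv, norm_exp_two_I_mul, inv_one]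

theorem norm_sign_le_one (j : ℤ) : ‖((j.sign : ℤ) : ℂ)‖ ≤ 1 := by
  rcases Int.sign_trichotomy j with h | h | h <;> simp [h]

theorem norm_oscillatory_matrix_le (x : ℝ) (j : ℤ) :
    ‖(!![1, Complex.exp (-(2 * Complex.I * x * (j : ℂ)));
      -Complex.exp (2 * Complex.I * x * (j : ℂ)), -1] : Matrix (Fin 2) (Fin 2) ℂ)‖ ≤ 2 := by
  refine (norm_matrix_two_le (c := 1) fun i k => ?_).trans (by norm_num)
  fin_cases i <;> fin_cases k <;> simp [norm_exp_two_I_mul, norm_exp_neg_two_I_mul]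

theorem norm_Nmat_le (j : ℤ) {r x : ℝ} (hr : 0 < r) (hx : r < |x|) :
    ‖Nmat j (x : ℂ)‖ ≤ 1 / r := by
  have hx0 : 0 < |x| := hr.trans hx
  have hxc : (x : ℂ) ≠ 0 := by exact_mod_cast abs_pos.1 hx0
  rw [Nmat_of_ne_zero j hxc, norm_smul]
  have h1 : ‖((j.sign : ℤ) : ℂ) / (2 * Complex.I * x)‖ ≤ 1 / (2 * r) := by
    rw [norm_div]
    refine div_le_div₀ zero_le_one (norm_sign_le_one j) (by positivity) ?_
    simp; exact hx.le
  calc _ ≤ 1 / (2 * r) * 2 := mul_le_mul h1 (norm_oscillatory_matrix_le x j) (norm_nonneg _)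
        (by positivity)
    _ = 1 / r := by field_simp

theorem norm_NmatDeriv_le {j : ℤ} (hj : j ≠ 0) {r x : ℝ} (hr : 0 < r) (hx : r < |x|) :
    ‖NmatDeriv j x‖ ≤ |(j : ℝ)| * (2 / r + 1 / r ^ 2) := by
  have hx0 : 0 < |x| := hr.trans hx
  have hj1 : 1 ≤ |(j : ℝ)| := by exact_mod_cast Int.one_le_abs hj
  have h1 : ‖((j.sign : ℤ) : ℂ) / (2 * Complex.I * x)‖ ≤ 1 / (2 * r) := by
    rw [norm_div]
    refine div_le_div₀ zero_le_one (norm_sign_le_one j) (by positivity) ?_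
    simp; exact hx.le
  have h2 : ‖-((j.sign : ℤ) : ℂ) / (2 * Complex.I * x ^ 2)‖ ≤ 1 / (2 * r ^ 2) := by
    rw [norm_div, norm_neg]
    refine div_le_div₀ zero_le_one (norm_sign_le_one j) (by positivity) ?_
    simp only [norm_mul, norm_pow, Complex.norm_ofNat, Complex.norm_I, Complex.norm_real,
      Real.norm_eq_abs, mul_one]
    gcongr
  have h3 : ‖(!![0, -(2 * Complex.I * j) * Complex.exp (-(2 * Complex.I * x * (j : ℂ)));
      -(2 * Complex.I * j) * Complex.exp (2 * Complex.I * x * (j : ℂ)), 0] :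
        Matrix (Fin 2) (Fin 2) ℂ)‖ ≤ 2 * (2 * |(j : ℝ)|) := by
    refine norm_matrix_two_le fun i k => ?_
    fin_cases i <;> fin_cases k <;> simp [norm_exp_two_I_mul, norm_exp_neg_two_I_mul]
  rw [NmatDeriv]
  refine (norm_add_le _ _).trans ?_
  rw [norm_smul, norm_smul]
  calc _ ≤ 1 / (2 * r) * (2 * (2 * |(j : ℝ)|)) + 1 / (2 * r ^ 2) * 2 :=
        add_le_add (mul_le_mul h1 h3 (norm_nonneg _) (by positivity))
          (mul_le_mul h2 (norm_oscillatory_matrix_le x j) (norm_nonneg _) (by positivity))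
    _ = |(j : ℝ)| * (2 / r) + 1 * (1 / r ^ 2) := by field_simp
    _ ≤ |(j : ℝ)| * (2 / r) + |(j : ℝ)| * (1 / r ^ 2) := by gcongr
    _ = _ := by ring

variable {α : ℤ → ℝ} {j : ℕ → ℤ} {P : ℂ → ℕ → Matrix (Fin 2) (Fin 2) ℂ}

theorem exists_tendsto_inv_transfer_contDiffOn (hj : ∀ n, j n ≠ 0)
    (hα : Summable fun n => |(j n : ℝ)| * |α (j n)|)
    (hP0 : ∀ lam, P lam 0 = 1) (hP : ∀ lam n, P lam (n + 1) = Mmat α (j n) lam * P lam n)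
    {r : ℝ} (hr : 0 < r) :
    ∃ L : ℝ → Matrix (Fin 2) (Fin 2) ℂ,
      (∀ x ∈ {x : ℝ | r < |x|}, Tendsto (fun n => (P (x : ℂ) n)⁻¹) atTop (𝓝 (L x))) ∧
      ContDiffOn ℝ 1 L {x : ℝ | r < |x|} := by
  have hne {x : ℝ} (hx : r < |x|) : x ≠ 0 := abs_pos.1 (hr.trans hx)
  refine exists_tendsto_partialProd_contDiffOn
    (Q := fun n x => (P (x : ℂ) n)⁻¹)
    (F := fun n x => -((α (j n) : ℂ) • Nmat (j n) x))
    (F' := fun n x => -((α (j n) : ℂ) • NmatDeriv (j n) x))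
    (u := fun n => |(j n : ℝ)| * |α (j n)| * (1 / r))
    (v := fun n => |(j n : ℝ)| * |α (j n)| * (2 / r + 1 / r ^ 2))
    (isOpen_lt continuous_const continuous_abs) ?_ ?_ ?_ ?_ ?_ ?_
    (hα.mul_right _) (hα.mul_right _)
  · intro x _
    simp [hP0]
  · intro n x hx
    rw [hP, Matrix.mul_inv_rev, Mmat_inv α _ (by exact_mod_cast hne hx)]
  · intro n x hx
    exact ((hasDerivAt_Nmat (j n) (hne hx)).const_smul (α (j n) : ℂ)).neg
  · intro n
    exact (((continuousOn_NmatDeriv (j n)).mono fun x hx => hne hx).const_smul (α (j n) : ℂ)).neg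
  · intro n x hx
    have hj1 : 1 ≤ |(j n : ℝ)| := by exact_mod_cast Int.one_le_abs (hj n)
    rw [norm_neg, norm_smul, Complex.norm_real, Real.norm_eq_abs]
    refine mul_le_mul ?_ (norm_Nmat_le _ hr hx) (norm_nonneg _) (by positivity)
    exact le_mul_of_one_le_left (abs_nonneg _) hj1
  · intro n x hx
    rw [norm_neg, norm_smul, Complex.norm_real, Real.norm_eq_abs]
    calc _ ≤ |α (j n)| * (|(j n : ℝ)| * (2 / r + 1 / r ^ 2)) := by
          gcongr; exact norm_NmatDeriv_le (hj n) hr hx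
      _ = _ := by ring

theorem det_transfer (hP0 : ∀ lam, P lam 0 = 1)
    (hP : ∀ lam n, P lam (n + 1) = Mmat α (j n) lam * P lam n) {lam : ℂ} (h : lam ≠ 0) (n : ℕ) :
    (P lam n).det = 1 := by
  induction n with
  | zero => simp [hP0]
  | succ n ih => rw [hP, Matrix.det_mul, det_Mmat α _ h, ih, one_mul]

theorem exists_limit_inv_transfer (hj : ∀ n, j n ≠ 0)
    (hα : Summable fun n => |(j n : ℝ)| * |α (j n)|)
    (hP0 : ∀ lam, P lam 0 = 1) (hP : ∀ lam n, P lam (n + 1) = Mmat α (j n) lam * P lam n) :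
    ∃ L : ℝ → Matrix (Fin 2) (Fin 2) ℂ,
      (∀ x : ℝ, x ≠ 0 → Tendsto (fun n => (P (x : ℂ) n)⁻¹) atTop (𝓝 (L x)) ∧ (L x).det = 1) ∧
      ∀ i k, ContDiffOn ℝ 1 (fun x => L x i k) {x : ℝ | x ≠ 0} := by
  have hmem {x : ℝ} (hx : x ≠ 0) : x ∈ {y : ℝ | |x| / 2 < |y|} :=
    half_lt_self (abs_pos.2 hx)
  have hex (x : ℝ) (hx : x ≠ 0) :=
    exists_tendsto_inv_transfer_contDiffOn hj hα hP0 hP (half_pos (abs_pos.2 hx))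
  have hlim (x : ℝ) (hx : x ≠ 0) : Tendsto (fun n => (P (x : ℂ) n)⁻¹) atTop
      (𝓝 (limUnder atTop fun n => (P (x : ℂ) n)⁻¹)) := by
    obtain ⟨L, hL, -⟩ := hex x hx
    exact tendsto_nhds_limUnder ⟨L x, hL x (hmem hx)⟩
  refine ⟨fun x => limUnder atTop fun n => (P (x : ℂ) n)⁻¹, fun x hx => ⟨hlim x hx, ?_⟩, ?_⟩
  · have hdet : Tendsto (fun n => ((P (x : ℂ) n)⁻¹).det) atTop
        (𝓝 (limUnder atTop fun n => (P (x : ℂ) n)⁻¹).det) :=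
      ((continuous_id.matrix_det).tendsto _).comp (hlim x hx)
    refine tendsto_nhds_unique hdet (tendsto_const_nhds.congr fun n => ?_)
    rw [Matrix.det_nonsing_inv, det_transfer hP0 hP (by exact_mod_cast hx), Ring.inverse_one]
  · intro i k x hx
    obtain ⟨L, hL, hLc⟩ := hex x hx
    have hopen : IsOpen {y : ℝ | |x| / 2 < |y|} := isOpen_lt continuous_const continuous_abs
    have hentry : ContDiff ℝ 1 fun B : Matrix (Fin 2) (Fin 2) ℂ => B i k :=
      (Matrix.entryLinearMap ℝ ℂ i k).toContinuousLinearMap.contDiff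
    have hLik : ContDiffAt ℝ 1 (fun y => L y i k) x :=
      hentry.contDiffAt.comp x (hLc.contDiffAt (hopen.mem_nhds (hmem hx)))
    refine (hLik.congr_of_eventuallyEq ?_).contDiffWithinAt
    filter_upwards [hopen.mem_nhds (hmem hx)] with y hy
    rw [(hL y hy).limUnder_eq]

end Transfer

/-- If `α ∈ ℓ^{1,1}(ℤ)`, then for every real `λ ≠ 0` the sequences `(P_j(λ)⁻¹)_{j ≥ 1}`
and `(P_j(λ)⁻¹)_{j ≤ -1}` converge (as `j → +∞` resp. `j → -∞`) to matrices of
determinant `1`, and the limit maps are continuously differentiable on `ℝ ∖ {0}`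
(componentwise). -/
theorem statement0 (α : ℤ → ℝ) (hα : Summable fun j : ℤ => |(j : ℝ)| * |α j|) :
    ∃ Qp Qm : ℝ → Matrix (Fin 2) (Fin 2) ℂ,
      (∀ lam : ℝ, lam ≠ 0 →
        Tendsto (fun n : ℕ => (Ppos α (lam : ℂ) n)⁻¹) atTop (nhds (Qp lam)) ∧
        (Qp lam).det = 1 ∧
        Tendsto (fun n : ℕ => (Pneg α (lam : ℂ) n)⁻¹) atTop (nhds (Qm lam)) ∧
        (Qm lam).det = 1) ∧
      (∀ i k : Fin 2,
        ContDiffOn ℝ 1 (fun lam : ℝ => Qp lam i k) {lam : ℝ | lam ≠ 0} ∧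
        ContDiffOn ℝ 1 (fun lam : ℝ => Qm lam i k) {lam : ℝ | lam ≠ 0}) := by
  obtain ⟨Qp, hp, hpc⟩ := exists_limit_inv_transfer (α := α) (j := fun n : ℕ => (n : ℤ) + 1)
    (P := Ppos α) (fun n => by omega)
    (hα.comp_injective (i := fun n : ℕ => (n : ℤ) + 1) fun a b h => by simpa using h)
    (fun _ => rfl) (fun _ _ => rfl)
  obtain ⟨Qm, hm, hmc⟩ := exists_limit_inv_transfer (α := α) (j := fun n : ℕ => -((n : ℤ) + 1))
    (P := Pneg α) (fun n => by omega)
    (hα.comp_injective (i := fun n : ℕ => -((n : ℤ) + 1)) fun a b h => by simpa using h)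
    (fun _ => rfl) (fun _ _ => rfl)
  exact ⟨Qp, Qm, fun x hx => ⟨(hp x hx).1, (hp x hx).2, (hm x hx).1, (hm x hx).2⟩,
    fun i k => ⟨hpc i k, hmc i k⟩⟩
end

section
/- For every λ ∈ ℂ∖{0}, every n ≥ 1 and all integers 1 ≤ j₁ < j₂ < ⋯ < j_n, one has the rank-one product formula N_{j₁}(λ) N_{j₂}(λ) ⋯ N_{j_n}(λ) = (2iλ)^{−n} · ∏_{k=1}^{n−1} (1 − e^{2iλ(j_{k+1} − j_k)}) · u vᵀ, where u = (1, −e^{2iλ j₁})ᵀ ∈ ℂ² and v = (1, e^{−2iλ j_n})ᵀ ∈ ℂ² (for n = 1 the empty product equals 1). -/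
open Complex Matrix

/-- The matrix `N_j(λ)` (for `j ≥ 1`, so no sign factor). -/
noncomputable def NmatP (j : ℤ) (lam : ℂ) : Matrix (Fin 2) (Fin 2) ℂ :=
  (1 / (2 * Complex.I * lam)) •
    !![1, Complex.exp (-(2 * Complex.I * lam * (j : ℂ)));
       -Complex.exp (2 * Complex.I * lam * (j : ℂ)), -1]

/-- A product of scaled rank-one matrices `c • u k (v k)ᵀ` telescopes to a rank-one matrix. -/
theorem Matrix.prod_map_range_smul_vecMulVec {R m : Type*} [CommSemiring R] [Fintype m]
    [DecidableEq m] (c : R) (u v : ℕ → m → R) (n : ℕ) :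
    ((List.range (n + 1)).map (fun k => c • vecMulVec (u k) (v k))).prod =
      (c ^ (n + 1) * ∏ k ∈ Finset.range n, v k ⬝ᵥ u (k + 1)) • vecMulVec (u 0) (v n) := by
  induction n with
  | zero => simp
  | succ n ih =>
    rw [List.range_succ, List.map_append, List.prod_append, ih]
    simp only [List.map_cons, List.map_nil, List.prod_cons, List.prod_nil, mul_one,
      smul_mul_assoc, mul_smul_comm, vecMulVec_mul_vecMulVec, vecMulVec_smul, smul_smul]
    rw [Finset.prod_range_succ]
    congr 1
    ring

/-- The matrix `N_j(λ)` is a multiple of the rank-one matrix with factors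
`(1, -e^{2iλj})` and `(1, e^{-2iλj})`. -/
theorem NmatP_eq_smul_vecMulVec (j : ℤ) (lam : ℂ) :
    NmatP j lam = (2 * Complex.I * lam)⁻¹ •
      vecMulVec ![1, -Complex.exp (2 * Complex.I * lam * (j : ℂ))]
        ![1, Complex.exp (-(2 * Complex.I * lam * (j : ℂ)))] := by
  rw [NmatP, one_div]
  congr 1
  ext a b
  fin_cases a <;> fin_cases b <;> simp [vecMulVec_apply, ← Complex.exp_add]

/-- Rank-one product formula: for `λ ≠ 0`, `n ≥ 1` and `1 ≤ j₁ < j₂ < ⋯ < j_n`,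
`N_{j₁}(λ) ⋯ N_{j_n}(λ) = (2iλ)^{-n} ∏_{k=1}^{n-1} (1 − e^{2iλ(j_{k+1}−j_k)}) · u vᵀ`,
where `u = (1, −e^{2iλ j₁})ᵀ` and `v = (1, e^{−2iλ j_n})ᵀ`. -/
theorem statement4 (lam : ℂ) (hlam : lam ≠ 0) (n : ℕ) (hn : 1 ≤ n) (j : ℕ → ℤ)
    (hj1 : 1 ≤ j 0) (hmono : ∀ k : ℕ, k + 1 < n → j k < j (k + 1)) :
    ((List.range n).map (fun k => NmatP (j k) lam)).prod =
      ((2 * Complex.I * lam)⁻¹ ^ n *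
        ∏ k ∈ Finset.range (n - 1),
          (1 - Complex.exp (2 * Complex.I * lam * ((j (k + 1) : ℂ) - (j k : ℂ))))) •
        Matrix.vecMulVec
          ![1, -Complex.exp (2 * Complex.I * lam * (j 0 : ℂ))]
          ![1, Complex.exp (-(2 * Complex.I * lam * (j (n - 1) : ℂ)))] := by
  obtain ⟨m, rfl⟩ := Nat.exists_eq_add_of_le' hn
  simp only [NmatP_eq_smul_vecMulVec, Nat.add_sub_cancel]
  rw [prod_map_range_smul_vecMulVec _
    (fun k => ![1, -Complex.exp (2 * Complex.I * lam * (j k : ℂ))])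
    (fun k => ![1, Complex.exp (-(2 * Complex.I * lam * (j k : ℂ)))])]
  congr 2
  refine Finset.prod_congr rfl fun k _ => ?_
  simp only [cons_dotProduct_cons, dotProduct_of_isEmpty, mul_one, mul_neg, ← Complex.exp_add,
    add_zero, ← sub_eq_add_neg]
  congr 2
  ring
end

section
/- Assume α ∈ ℓ^{1,1}(ℤ) and let λ ∈ ℂ with Im λ > 0 or λ ∈ ℝ∖{0}. Then there exist sequences A⁺, B⁺ : ℤ → ℂ satisfying the (α,λ)-matching conditions with A⁺_j → 1 and B⁺_j e^{2 Im(λ) j} → 0 as j → +∞, and there exist sequences A⁻, B⁻ : ℤ → ℂ satisfying the (α,λ)-matching conditions with A⁻_j e^{−2 Im(λ) j} → 0 and B⁻_j → 1 as j → −∞. Moreover, if λ ∈ ℝ∖{0}, then all four sequences A⁺, B⁺, A⁻, B⁻ are bounded. (The associated piecewise functions f_±(λ,x) = A^±_j e^{iλx} + B^±_j e^{−iλx} for x ∈ [j, j+1) are the Jost solutions: continuous solutions of −f'' = λ²f on ℝ∖ℤ whose derivative jumps by α_j f(j) at each integer j, with f_+(λ,x) ∼ e^{iλx} as x → +∞ and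 f_−(λ,x) ∼ e^{−iλx} as x → −∞; in particular f_± ∈ L^∞(ℝ) when λ ∈ ℝ∖{0}.) -/
open Complex Filter

/-- The `(α,λ)`-matching conditions for a pair of sequences `A B : ℤ → ℂ`:
continuity and derivative-jump conditions at every integer `j`. -/
def Matching (α : ℤ → ℝ) (lam : ℂ) (A B : ℤ → ℂ) : Prop :=
  ∀ j : ℤ,
    (A j * Complex.exp (Complex.I * lam * (j : ℂ)) +
        B j * Complex.exp (-(Complex.I * lam * (j : ℂ))) =
      A (j - 1) * Complex.exp (Complex.I * lam * (j : ℂ)) +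
        B (j - 1) * Complex.exp (-(Complex.I * lam * (j : ℂ)))) ∧
    (Complex.I * lam * (A j * Complex.exp (Complex.I * lam * (j : ℂ)) -
          B j * Complex.exp (-(Complex.I * lam * (j : ℂ)))) -
        Complex.I * lam * (A (j - 1) * Complex.exp (Complex.I * lam * (j : ℂ)) -
          B (j - 1) * Complex.exp (-(Complex.I * lam * (j : ℂ)))) =
      (α j : ℂ) * (A j * Complex.exp (Complex.I * lam * (j : ℂ)) +
        B j * Complex.exp (-(Complex.I * lam * (j : ℂ)))))

section BackwardRecursion

variable {E : Type*} [NormedAddCommGroup E] [NormedSpace ℂ E]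

/-- The ordered product `T (j + 1) * T (j + 2) * ⋯ * T (j + n)`. -/
noncomputable def shiftedProd (T : ℤ → E →L[ℂ] E) (j : ℤ) : ℕ → E →L[ℂ] E
  | 0 => ContinuousLinearMap.id ℂ E
  | n + 1 => (shiftedProd T j n).comp (T (j + n + 1))

lemma shiftedProd_sub_one_succ (T : ℤ → E →L[ℂ] E) (j : ℤ) (n : ℕ) :
    shiftedProd T (j - 1) (n + 1) = (T j).comp (shiftedProd T j n) := by
  induction n with
  | zero => ext x; simp [shiftedProd]
  | succ n ih =>
    rw [shiftedProd, ih, shiftedProd, ContinuousLinearMap.comp_assoc]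
    congr 4
    push_cast
    ring

lemma injective_add_natCast_add_one (j : ℤ) :
    Function.Injective fun n : ℕ => j + (n : ℤ) + 1 := by
  intro a b h
  simpa using h

lemma norm_shiftedProd_le {T : ℤ → E →L[ℂ] E} {r : ℤ → ℝ} (hr : Summable r)
    (hr0 : ∀ j, 0 ≤ r j) (hT : ∀ j, ‖T j‖ ≤ 1 + r j) (j : ℤ) (n : ℕ) :
    ‖shiftedProd T j n‖ ≤ Real.exp (∑' k, r k) := by
  have hprod : ‖shiftedProd T j n‖ ≤ Real.exp (∑ k ∈ Finset.range n, r (j + k + 1)) := by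
    induction n with
    | zero => simpa [shiftedProd] using ContinuousLinearMap.norm_id_le
    | succ n ih =>
      rw [shiftedProd, Finset.sum_range_succ, Real.exp_add]
      refine (ContinuousLinearMap.opNorm_comp_le _ _).trans ?_
      gcongr
      refine (hT _).trans ?_
      rw [add_comm]
      exact Real.add_one_le_exp _
  refine hprod.trans (Real.exp_le_exp.2 ?_)
  have hinj := injective_add_natCast_add_one j
  calc ∑ k ∈ Finset.range n, r (j + k + 1) ≤ ∑' k : ℕ, r (j + k + 1) :=
        (hr.comp_injective hinj).sum_le_tsum _ fun _ _ => hr0 _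
    _ ≤ ∑' k, r k := tsum_comp_le_tsum_of_inj hr hr0 hinj

/-- A backward linear recursion whose coefficients are a summable perturbation of contractions
fixing `e` has a bounded solution converging to `e` at `+∞`. -/
lemma exists_backward_solution [CompleteSpace E] {T : ℤ → E →L[ℂ] E} {r : ℤ → ℝ} {e : E}
    (hr : Summable r) (hr0 : ∀ j, 0 ≤ r j) (hT : ∀ j, ‖T j‖ ≤ 1 + r j)
    (he : ∀ j, ‖T j e - e‖ ≤ r j) :
    ∃ v : ℤ → E, (∀ j, v (j - 1) = T j (v j)) ∧ Tendsto v atTop (nhds e) ∧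
      ∃ C : ℝ, ∀ j, ‖v j‖ ≤ C := by
  set M := Real.exp (∑' k, r k)
  have hP := norm_shiftedProd_le hr hr0 hT
  have hdist (j : ℤ) (n : ℕ) :
      dist (shiftedProd T j n e) (shiftedProd T j (n + 1) e) ≤ M * r (j + n + 1) := by
    rw [dist_comm, dist_eq_norm, shiftedProd, ContinuousLinearMap.comp_apply, ← map_sub]
    exact (ContinuousLinearMap.le_opNorm _ _).trans
      (mul_le_mul (hP j n) (he _) (norm_nonneg _) (Real.exp_pos _).le)
  have hsum (j : ℤ) : Summable fun n : ℕ => M * r (j + n + 1) :=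
    (hr.comp_injective (injective_add_natCast_add_one j)).mul_left M
  have hlim (j : ℤ) : ∃ x, Tendsto (fun n => shiftedProd T j n e) atTop (nhds x) :=
    cauchySeq_tendsto_of_complete (cauchySeq_of_dist_le_of_summable _ (hdist j) (hsum j))
  choose v hv using hlim
  refine ⟨v, fun j => ?_, ?_, M * ‖e‖, fun j => ?_⟩
  · have h1 := (tendsto_add_atTop_iff_nat 1).2 (hv (j - 1))
    simp only [shiftedProd_sub_one_succ, ContinuousLinearMap.comp_apply] at h1
    exact tendsto_nhds_unique h1 (((T j).continuous.tendsto _).comp (hv j))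
  · rw [← Nat.map_cast_int_atTop, tendsto_map'_iff, tendsto_iff_dist_tendsto_zero]
    have htail := tendsto_sum_nat_add fun n : ℕ => M * r ((n : ℤ) + 1)
    refine squeeze_zero (fun _ => dist_nonneg) (fun m => ?_) htail
    have h := dist_le_tsum_of_dist_le_of_tendsto₀ _ (hdist m) (hsum m) (hv m)
    rw [dist_comm]
    simpa [shiftedProd, add_comm, add_left_comm] using h
  · exact le_of_tendsto (hv j).norm (Eventually.of_forall fun n =>
      (ContinuousLinearMap.le_opNorm _ _).trans (by gcongr; exact hP j n))

end BackwardRecursion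

/-- The backward transfer map `(A_j, e^{-2iλj} B_j) ↦ (A_{j-1}, e^{-2iλ(j-1)} B_{j-1})`,
with `c = α_j / (2iλ)` and `q = e^{2iλ}`. -/
noncomputable def transferMap (c q : ℂ) : ℂ × ℂ →ₗ[ℂ] ℂ × ℂ where
  toFun p := (p.1 - c * (p.1 + p.2), q * (p.2 + c * (p.1 + p.2)))
  map_add' x y := by ext <;> simp <;> ring
  map_smul' a x := by ext <;> simp <;> ring

lemma norm_transferMap_le {c q : ℂ} (hq : ‖q‖ ≤ 1) (p : ℂ × ℂ) :
    ‖transferMap c q p‖ ≤ (1 + 2 * ‖c‖) * ‖p‖ := by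
  have h1 := norm_fst_le p
  have h2 := norm_snd_le p
  have hc : ‖c * (p.1 + p.2)‖ ≤ ‖c‖ * (2 * ‖p‖) := by
    rw [norm_mul]
    gcongr
    linarith [norm_add_le p.1 p.2]
  refine max_le ?_ ?_
  · change ‖p.1 - c * (p.1 + p.2)‖ ≤ _
    linarith [norm_sub_le p.1 (c * (p.1 + p.2))]
  · change ‖q * (p.2 + c * (p.1 + p.2))‖ ≤ _
    rw [norm_mul]
    refine (mul_le_of_le_one_left (norm_nonneg _) hq).trans ?_
    linarith [norm_add_le p.2 (c * (p.1 + p.2))]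

lemma norm_transferMap_sub_le {c q : ℂ} (hq : ‖q‖ ≤ 1) :
    ‖transferMap c q (1, 0) - (1, 0)‖ ≤ 2 * ‖c‖ := by
  refine max_le ?_ ?_
  · simp [transferMap]
    linarith [norm_nonneg c]
  · simp [transferMap]
    nlinarith [norm_nonneg c, norm_nonneg q]

lemma norm_exp_two_mul_I_mul (lam : ℂ) (x : ℝ) :
    ‖Complex.exp (2 * Complex.I * lam * x)‖ = Real.exp (-(2 * lam.im * x)) := by
  rw [Complex.norm_exp]
  simp

/-- The Jost coefficients at `+∞` exist for every summable potential. -/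
lemma exists_jost_atTop {α : ℤ → ℝ} (hα : Summable fun j => |α j|) {lam : ℂ}
    (him : 0 ≤ lam.im) (h0 : lam ≠ 0) :
    ∃ A B : ℤ → ℂ, Matching α lam A B ∧ Tendsto A atTop (nhds 1) ∧
      Tendsto (fun j : ℤ => B j * (Real.exp (2 * lam.im * (j : ℝ)) : ℂ)) atTop (nhds 0) ∧
      (lam.im = 0 → ∃ C : ℝ, ∀ j : ℤ, ‖A j‖ ≤ C ∧ ‖B j‖ ≤ C) := by
  set q := Complex.exp (2 * Complex.I * lam) with hq_def
  have hq : ‖q‖ ≤ 1 := by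
    have h := norm_exp_two_mul_I_mul lam 1
    rw [Complex.ofReal_one, mul_one] at h
    rw [hq_def, h, Real.exp_le_one_iff]
    linarith
  set c : ℤ → ℂ := fun j => α j / (2 * Complex.I * lam) with hc_def
  have hr : Summable fun j => 2 * ‖c j‖ := by
    refine Summable.mul_left 2 ?_
    simpa [hc_def] using hα.div_const (2 * ‖lam‖)
  obtain ⟨v, hrec, hv, C, hC⟩ := exists_backward_solution
    (T := fun j => (transferMap (c j) q).mkContinuous _ (norm_transferMap_le hq))
    (e := (1, 0)) hr (fun _ => by positivity)
    (fun _ => LinearMap.mkContinuous_norm_le _ (by positivity) _)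
    (fun _ => norm_transferMap_sub_le hq)
  have hv1 := (continuous_fst.tendsto _).comp hv
  have hv2 := (continuous_snd.tendsto _).comp hv
  have hnorm (j : ℤ) :
      ‖Complex.exp (2 * Complex.I * lam * j)‖ = Real.exp (-(2 * lam.im * j)) := by
    simpa using norm_exp_two_mul_I_mul lam j
  refine ⟨fun j => (v j).1, fun j => (v j).2 * Complex.exp (2 * Complex.I * lam * j),
    fun j => ?_, hv1, ?_, fun him0 => ⟨C, fun j => ⟨(norm_fst_le _).trans (hC j), ?_⟩⟩⟩
  · have h1 : (v (j - 1)).1 = (v j).1 - c j * ((v j).1 + (v j).2) := by rw [hrec]; rfl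
    have h2 : (v (j - 1)).2 = q * ((v j).2 + c j * ((v j).1 + (v j).2)) := by rw [hrec]; rfl
    have hE : Complex.exp (2 * Complex.I * lam * j) = Complex.exp (Complex.I * lam * j) ^ 2 := by
      rw [← Complex.exp_nat_mul]; congr 1; push_cast; ring
    have hF : q * Complex.exp (2 * Complex.I * lam * (j - 1 : ℤ)) =
        Complex.exp (Complex.I * lam * j) ^ 2 := by
      rw [← Complex.exp_nat_mul, hq_def, ← Complex.exp_add]; congr 1; push_cast; ring
    have hc : 2 * Complex.I * lam * c j = α j := by
      simp only [hc_def]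
      field_simp
    have hne := Complex.exp_ne_zero (Complex.I * lam * j)
    simp only [h1, h2, hE, Complex.exp_neg, ← hc]
    generalize Complex.exp (Complex.I * lam * j) = E at *
    generalize Complex.exp (2 * Complex.I * lam * (j - 1 : ℤ)) = F at *
    have hF' (x : ℂ) : q * x * F * E⁻¹ = x * E := by
      rw [mul_right_comm q, hF]; field_simp
    have hE' (x : ℂ) : x * E ^ 2 * E⁻¹ = x * E := by field_simp
    rw [hF', hE']
    constructor <;> ring
  · rw [tendsto_zero_iff_norm_tendsto_zero] at hv2 ⊢
    refine hv2.congr fun j => ?_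
    simp only [Function.comp_apply]
    rw [norm_mul, norm_mul, hnorm, Complex.norm_real, Real.norm_of_nonneg (Real.exp_pos _).le,
      mul_assoc, ← Real.exp_add, neg_add_cancel, Real.exp_zero, mul_one]
  · rw [norm_mul, hnorm, him0]
    simpa using (norm_snd_le _).trans (hC j)

/-- Reflection `x ↦ -x` preserves the matching conditions. -/
lemma Matching.reflect {α : ℤ → ℝ} {lam : ℂ} {A B : ℤ → ℂ}
    (h : Matching (fun j => α (-j)) lam A B) :
    Matching α lam (fun j => B (-j - 1)) (fun j => A (-j - 1)) := by
  intro j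
  obtain ⟨h1, h2⟩ := h (-j)
  simp only [Int.cast_neg, mul_neg, neg_neg] at h1 h2
  have hj : -(j - 1) - 1 = -j := by ring
  simp only [hj]
  constructor
  · linear_combination -h1
  · linear_combination h2 + α j * h1

lemma summable_abs_of_summable_abs_mul {α : ℤ → ℝ}
    (hα : Summable fun j : ℤ => |(j : ℝ)| * |α j|) : Summable fun j => |α j| := by
  refine hα.of_norm_bounded_eventually ?_
  filter_upwards [(Set.finite_singleton (0 : ℤ)).compl_mem_cofinite] with j hj
  rw [Real.norm_of_nonneg (abs_nonneg _)]
  refine le_mul_of_one_le_left (abs_nonneg _) ?_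
  exact_mod_cast Int.one_le_abs (by simpa using hj)

/-- Existence of the Jost coefficients: if `α ∈ ℓ^{1,1}(ℤ)` and `Im λ > 0` or
`λ ∈ ℝ ∖ {0}`, there are sequences `A⁺, B⁺` (resp. `A⁻, B⁻`) satisfying the
matching conditions with `A⁺_j → 1`, `B⁺_j e^{2 Im(λ) j} → 0` as `j → +∞`
(resp. `A⁻_j e^{−2 Im(λ) j} → 0`, `B⁻_j → 1` as `j → −∞`); if moreover `λ` is real
then all four sequences are bounded. -/
theorem statement5 (α : ℤ → ℝ) (hα : Summable fun j : ℤ => |(j : ℝ)| * |α j|)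
    (lam : ℂ) (hlam : 0 < lam.im ∨ (lam.im = 0 ∧ lam ≠ 0)) :
    ∃ Ap Bp Am Bm : ℤ → ℂ,
      Matching α lam Ap Bp ∧ Matching α lam Am Bm ∧
      Tendsto Ap atTop (nhds 1) ∧
      Tendsto (fun j : ℤ => Bp j * (Real.exp (2 * lam.im * (j : ℝ)) : ℂ)) atTop (nhds 0) ∧
      Tendsto (fun j : ℤ => Am j * (Real.exp (-(2 * lam.im * (j : ℝ))) : ℂ)) atBot (nhds 0) ∧
      Tendsto Bm atBot (nhds 1) ∧
      (lam.im = 0 → ∃ C : ℝ, ∀ j : ℤ,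
        ‖Ap j‖ ≤ C ∧ ‖Bp j‖ ≤ C ∧ ‖Am j‖ ≤ C ∧ ‖Bm j‖ ≤ C) := by
  have hα' := summable_abs_of_summable_abs_mul hα
  have him : 0 ≤ lam.im := hlam.elim le_of_lt fun h => h.1.ge
  have h0 : lam ≠ 0 := hlam.elim (fun h h0 => by simp [h0] at h) fun h => h.2
  have hrefl : Summable fun j : ℤ => |α (-j)| := hα'.comp_injective neg_injective
  obtain ⟨A, B, hm, hA, hB, hbdd⟩ := exists_jost_atTop hα' him h0
  obtain ⟨A', B', hm', hA', hB', hbdd'⟩ := exists_jost_atTop hrefl him h0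
  have hshift : Tendsto (fun j : ℤ => -j - 1) atBot atTop :=
    tendsto_atTop_add_const_right _ (-1) tendsto_neg_atBot_atTop
  refine ⟨A, B, _, _, hm, hm'.reflect, hA, hB, ?_, hA'.comp hshift, fun hreal => ?_⟩
  · have h := (hB'.comp hshift).mul_const (Real.exp (2 * lam.im) : ℂ)
    rw [zero_mul] at h
    refine h.congr fun j => ?_
    simp only [Function.comp_apply]
    rw [mul_assoc, ← Complex.ofReal_mul, ← Real.exp_add]
    congr 3
    push_cast
    ring
  · obtain ⟨C, hC⟩ := hbdd hreal
    obtain ⟨C', hC'⟩ := hbdd' hreal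
    exact ⟨max C C', fun j => ⟨le_max_of_le_left (hC j).1, le_max_of_le_left (hC j).2,
      le_max_of_le_right (hC' _).2, le_max_of_le_right (hC' _).1⟩⟩
end

section
/- Assume α ∈ ℓ^{1,1}(ℤ) and let λ ∈ ℝ∖{0}. Let (A⁺, B⁺) satisfy the (α,λ)-matching conditions with (A⁺_j, B⁺_j) → (1, 0) as j → +∞, and let (A⁻, B⁻) satisfy the (α,λ)-matching conditions with (A⁻_j, B⁻_j) → (0, 1) as j → −∞. Then for every j ∈ ℤ, |A⁺_j B⁻_j − B⁺_j A⁻_j| ≥ 1. In particular the Wronskian of the two Jost solutions, W(λ) := −2iλ (A⁺_j B⁻_j − B⁺_j A⁻_j) (which is independent of j), is nonzero. -/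
open Complex Filter

/-- Flux conservation across a single point interaction of real strength. -/
lemma normSq_sub_normSq_eq_of_jump {lam a : ℝ} (hlam : lam ≠ 0) {X Y X' Y' : ℂ}
    (hc : X + Y = X' + Y')
    (hd : I * lam * (X - Y) - I * lam * (X' - Y') = a * (X + Y)) :
    normSq X - normSq Y = normSq X' - normSq Y' := by
  have hc1 := congrArg re hc
  have hc2 := congrArg im hc
  have hd1 := congrArg re hd
  have hd2 := congrArg im hd
  simp at hc1 hc2 hd1 hd2
  apply mul_left_cancel₀ hlam
  simp only [normSq_apply]
  linear_combination (X.re + Y.re) * hd2 - (X.im + Y.im) * hd1 +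
    lam * (X'.re - Y'.re) * hc1 + lam * (X'.im - Y'.im) * hc2

/-- For real `λ ≠ 0`, the flux `|A_j|² - |B_j|²` does not depend on `j`. -/
lemma Matching.normSq_sub_normSq_eq {α : ℤ → ℝ} {lam : ℝ} {A B : ℤ → ℂ}
    (h : Matching α lam A B) (hlam : lam ≠ 0) (j k : ℤ) :
    normSq (A j) - normSq (B j) = normSq (A k) - normSq (B k) := by
  have step : ∀ j : ℤ, normSq (A j) - normSq (B j) =
      normSq (A (j - 1)) - normSq (B (j - 1)) := by
    intro j
    have hu : normSq (exp (I * lam * (j : ℂ))) = 1 := by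
      rw [normSq_eq_norm_sq, norm_exp]; simp
    have hv : normSq (exp (-(I * lam * (j : ℂ)))) = 1 := by
      rw [normSq_eq_norm_sq, norm_exp]; simp
    simpa [normSq_mul, hu, hv] using
      normSq_sub_normSq_eq_of_jump hlam (h j).1 (h j).2
  have const : ∀ j : ℤ, normSq (A j) - normSq (B j) = normSq (A 0) - normSq (B 0) := by
    intro j
    induction j using Int.induction_on with
    | zero => rfl
    | succ n ih => rw [step, add_sub_cancel_right, ih]
    | pred n ih => rw [← step, ih]
  rw [const j, const k]

lemma Matching.normSq_sub_normSq_eq_of_tendsto {α : ℤ → ℝ} {lam : ℝ} {A B : ℤ → ℂ}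
    (h : Matching α lam A B) (hlam : lam ≠ 0) {l : Filter ℤ} [l.NeBot] {a b : ℂ}
    (hA : Tendsto A l (nhds a)) (hB : Tendsto B l (nhds b)) (j : ℤ) :
    normSq (A j) - normSq (B j) = normSq a - normSq b := by
  have hlim := ((continuous_normSq.tendsto a).comp hA).sub
    ((continuous_normSq.tendsto b).comp hB)
  refine tendsto_nhds_unique (tendsto_const_nhds.congr fun k => ?_) hlim
  exact h.normSq_sub_normSq_eq hlam j k

/-- Reverse Cauchy–Schwarz inequality for a pair of vectors of unit flux. -/
lemma one_le_norm_mul_sub_mul {a b c d : ℂ} (h₁ : normSq a - normSq b = 1)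
    (h₂ : normSq d - normSq c = 1) : 1 ≤ ‖a * d - b * c‖ := by
  simp only [normSq_eq_norm_sq] at h₁ h₂
  have key : 1 + ‖b‖ * ‖c‖ ≤ ‖a‖ * ‖d‖ := by
    refine (sq_le_sq₀ (by positivity) (by positivity)).1 ?_
    rw [mul_pow, show ‖a‖ ^ 2 = 1 + ‖b‖ ^ 2 by linarith,
      show ‖d‖ ^ 2 = 1 + ‖c‖ ^ 2 by linarith]
    nlinarith [sq_nonneg (‖b‖ - ‖c‖)]
  have := norm_sub_norm_le (a * d) (b * c)
  rw [norm_mul, norm_mul] at this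
  linarith

/-- If `α ∈ ℓ^{1,1}(ℤ)`, `λ ∈ ℝ ∖ {0}`, `(A⁺,B⁺)` satisfies the matching
conditions with `(A⁺_j, B⁺_j) → (1,0)` as `j → +∞` and `(A⁻,B⁻)` satisfies them
with `(A⁻_j, B⁻_j) → (0,1)` as `j → −∞`, then `|A⁺_j B⁻_j − B⁺_j A⁻_j| ≥ 1` for
every `j`; in particular the Wronskian `W(λ) = −2iλ(A⁺_j B⁻_j − B⁺_j A⁻_j)` is
nonzero. -/
theorem statement8 (α : ℤ → ℝ) (hα : Summable fun j : ℤ => |(j : ℝ)| * |α j|)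
    (lam : ℝ) (hlam : lam ≠ 0) (Ap Bp Am Bm : ℤ → ℂ)
    (hp : Matching α (lam : ℂ) Ap Bp) (hm : Matching α (lam : ℂ) Am Bm)
    (hAp : Tendsto Ap atTop (nhds 1)) (hBp : Tendsto Bp atTop (nhds 0))
    (hAm : Tendsto Am atBot (nhds 0)) (hBm : Tendsto Bm atBot (nhds 1)) :
    ∀ j : ℤ, 1 ≤ ‖Ap j * Bm j - Bp j * Am j‖ ∧
      -(2 * Complex.I * (lam : ℂ)) * (Ap j * Bm j - Bp j * Am j) ≠ 0 := by
  intro j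
  have h₁ := hp.normSq_sub_normSq_eq_of_tendsto hlam hAp hBp j
  have h₂ := hm.normSq_sub_normSq_eq_of_tendsto hlam hAm hBm j
  simp only [map_one, map_zero] at h₁ h₂
  have h := one_le_norm_mul_sub_mul (a := Ap j) (b := Bp j) (c := Am j) (d := Bm j)
    (by linarith) (by linarith)
  refine ⟨h, mul_ne_zero (by simp [hlam]) ?_⟩
  exact norm_pos_iff.1 (by linarith)
end

section
/- Assume α ∈ ℓ^{1,1}(ℤ) and let λ ∈ ℝ∖{0}. Let (A⁻, B⁻) satisfy the (α,λ)-matching conditions with (A⁻_j, B⁻_j) → (0, 1) as j → −∞. Then the limits a(λ) := lim_{j→+∞} A⁻_j and b(λ) := lim_{j→+∞} B⁻_j exist in ℂ, and they satisfy |b(λ)|² = 1 + |a(λ)|². -/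
open Complex Filter

/-- The matching conditions in recursive form, after factoring out the oscillating exponentials:
a transfer step with purely imaginary coefficient `c = α_j / (2iλ)`. -/
theorem Matching.exists_transfer {α : ℤ → ℝ} {lam : ℝ} {A B : ℤ → ℂ} (hlam : lam ≠ 0)
    (hm : Matching α (lam : ℂ) A B) (j : ℤ) :
    ∃ e f c : ℂ, ‖e‖ = 1 ∧ ‖f‖ = 1 ∧ c.re = 0 ∧ 2 * |lam| * ‖c‖ = |α j| ∧
      A j * e = A (j - 1) * e + c * (A (j - 1) * e + B (j - 1) * f) ∧
      B j * f = B (j - 1) * f - c * (A (j - 1) * e + B (j - 1) * f) := by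
  obtain ⟨h1, h2⟩ := hm j
  have hl : (lam : ℂ) ≠ 0 := by exact_mod_cast hlam
  have he : Complex.I * lam * (j : ℂ) = ((lam * j : ℝ) : ℂ) * Complex.I := by
    push_cast; ring
  have he' : -(Complex.I * lam * (j : ℂ)) = ((-(lam * j) : ℝ) : ℂ) * Complex.I := by
    push_cast; ring
  have hc : ((-(α j / (2 * lam)) : ℝ) : ℂ) * Complex.I * (2 * (Complex.I * lam)) = α j := by
    push_cast
    field_simp
    linear_combination -(α j : ℂ) * Complex.I_sq
  have hn : (2 * (Complex.I * lam) : ℂ) ≠ 0 := by simp [hl]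
  refine ⟨Complex.exp (Complex.I * lam * (j : ℂ)), Complex.exp (-(Complex.I * lam * (j : ℂ))),
    ((-(α j / (2 * lam)) : ℝ) : ℂ) * Complex.I, ?_, ?_, ?_, ?_, ?_, ?_⟩
  · rw [he, Complex.norm_exp_ofReal_mul_I]
  · rw [he', Complex.norm_exp_ofReal_mul_I]
  · exact Complex.re_ofReal_mul _ _ |>.trans (by simp)
  · rw [norm_mul, Complex.norm_I, Complex.norm_real, Real.norm_eq_abs, abs_neg, abs_div, abs_mul,
      abs_two]
    have : |lam| ≠ 0 := abs_ne_zero.mpr hlam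
    field_simp
  all_goals
    rw [← hc] at h2
    generalize ((-(α j / (2 * lam)) : ℝ) : ℂ) * Complex.I = c at *
    generalize Complex.exp (Complex.I * lam * (j : ℂ)) = e at *
    generalize Complex.exp (-(Complex.I * lam * (j : ℂ))) = f at *
    apply mul_left_cancel₀ hn
  · linear_combination h2 + (Complex.I * lam + 2 * c * Complex.I * lam) * h1
  · linear_combination -h2 + (Complex.I * lam - 2 * c * Complex.I * lam) * h1

/-- A transfer step with purely imaginary coefficient preserves `‖q‖ ^ 2 - ‖p‖ ^ 2`. -/
theorem norm_sq_sub_norm_sq_transfer {c : ℂ} (hc : c.re = 0) (p q : ℂ) :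
    ‖q - c * (p + q)‖ ^ 2 - ‖p + c * (p + q)‖ ^ 2 = ‖q‖ ^ 2 - ‖p‖ ^ 2 := by
  simp only [Complex.sq_norm, Complex.normSq_apply, Complex.add_re, Complex.add_im,
    Complex.sub_re, Complex.sub_im, Complex.mul_re, Complex.mul_im, hc]
  ring

theorem Matching.norm_sq_sub_norm_sq_eq {α : ℤ → ℝ} {lam : ℝ} {A B : ℤ → ℂ} (hlam : lam ≠ 0)
    (hm : Matching α (lam : ℂ) A B) (j : ℤ) :
    ‖B j‖ ^ 2 - ‖A j‖ ^ 2 = ‖B 0‖ ^ 2 - ‖A 0‖ ^ 2 := by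
  have step (j : ℤ) : ‖B j‖ ^ 2 - ‖A j‖ ^ 2 = ‖B (j - 1)‖ ^ 2 - ‖A (j - 1)‖ ^ 2 := by
    obtain ⟨e, f, c, he, hf, hc, -, hA, hB⟩ := hm.exists_transfer hlam j
    have key := norm_sq_sub_norm_sq_transfer hc (A (j - 1) * e) (B (j - 1) * f)
    rw [← hA, ← hB] at key
    simpa [he, hf] using key
  induction j using Int.induction_on with
  | zero => rfl
  | succ n ih => rw [step, add_sub_cancel_right, ih]
  | pred n ih => rw [← step, ih]

theorem Matching.norm_sub_le {α : ℤ → ℝ} {lam : ℝ} {A B : ℤ → ℂ} (hlam : lam ≠ 0)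
    (hm : Matching α (lam : ℂ) A B) (j : ℤ) :
    ‖A j - A (j - 1)‖ ≤ |α j| / (2 * |lam|) * (‖A (j - 1)‖ + ‖B (j - 1)‖) ∧
      ‖B j - B (j - 1)‖ ≤ |α j| / (2 * |lam|) * (‖A (j - 1)‖ + ‖B (j - 1)‖) := by
  obtain ⟨e, f, c, he, hf, -, hc, hA, hB⟩ := hm.exists_transfer hlam j
  have hl : 0 < |lam| := abs_pos.mpr hlam
  have hc' : |α j| / (2 * |lam|) = ‖c‖ := by rw [← hc]; field_simp
  have hS : ‖A (j - 1) * e + B (j - 1) * f‖ ≤ ‖A (j - 1)‖ + ‖B (j - 1)‖ :=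
    (norm_add_le _ _).trans_eq (by simp [he, hf])
  have hcS : ‖c * (A (j - 1) * e + B (j - 1) * f)‖ ≤ ‖c‖ * (‖A (j - 1)‖ + ‖B (j - 1)‖) := by
    rw [norm_mul]; gcongr
  rw [hc']
  constructor
  · calc ‖A j - A (j - 1)‖ = ‖(A j - A (j - 1)) * e‖ := by rw [norm_mul, he, mul_one]
      _ = ‖c * (A (j - 1) * e + B (j - 1) * f)‖ := by congr 1; linear_combination hA
      _ ≤ _ := hcS
  · calc ‖B j - B (j - 1)‖ = ‖(B j - B (j - 1)) * f‖ := by rw [norm_mul, hf, mul_one]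
      _ = ‖-(c * (A (j - 1) * e + B (j - 1) * f))‖ := by congr 1; linear_combination hB
      _ ≤ _ := by rw [norm_neg]; exact hcS

/-- Discrete Grönwall inequality with summable coefficients. -/
theorem le_mul_exp_tsum_of_le_one_add_mul {u w : ℕ → ℝ} (hu : 0 ≤ u 0) (hw : ∀ n, 0 ≤ w n)
    (hs : Summable w) (h : ∀ n, u (n + 1) ≤ (1 + w n) * u n) (n : ℕ) :
    u n ≤ Real.exp (∑' k, w k) * u 0 := by
  have aux (n : ℕ) : u n ≤ Real.exp (∑ k ∈ Finset.range n, w k) * u 0 := by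
    induction n with
    | zero => simp
    | succ n ih =>
      have hn := hw n
      calc u (n + 1) ≤ (1 + w n) * u n := h n
        _ ≤ (1 + w n) * (Real.exp (∑ k ∈ Finset.range n, w k) * u 0) := by gcongr
        _ ≤ Real.exp (w n) * (Real.exp (∑ k ∈ Finset.range n, w k) * u 0) := by
          gcongr
          linarith [Real.add_one_le_exp (w n)]
        _ = _ := by rw [Finset.sum_range_succ, Real.exp_add]; ring
  refine (aux n).trans ?_
  gcongr
  exact hs.sum_le_tsum _ fun k _ => hw k

theorem tendsto_int_atTop_of_tendsto_natCast {X : Type*} {f : ℤ → X} {l : Filter X}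
    (h : Tendsto (fun n : ℕ => f n) atTop l) : Tendsto f atTop l := by
  rw [← Nat.map_cast_int_atTop, tendsto_map'_iff]
  exact h

theorem exists_tendsto_of_norm_sub_le {f : ℤ → ℂ} {d : ℕ → ℝ} (hd : Summable d)
    (h : ∀ n : ℕ, ‖f (n + 1) - f n‖ ≤ d n) : ∃ a, Tendsto f atTop (nhds a) := by
  have hc : CauchySeq fun n : ℕ => f n := by
    refine cauchySeq_of_dist_le_of_summable d (fun n => ?_) hd
    rw [dist_comm, dist_eq_norm]
    exact_mod_cast h n
  obtain ⟨a, ha⟩ := cauchySeq_tendsto_of_complete hc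
  exact ⟨a, tendsto_int_atTop_of_tendsto_natCast ha⟩

theorem Matching.exists_tendsto_atTop {α : ℤ → ℝ} {lam : ℝ} {A B : ℤ → ℂ} (hlam : lam ≠ 0)
    (hm : Matching α (lam : ℂ) A B) (hα : Summable fun n : ℕ => |α (n + 1)|) :
    ∃ a b : ℂ, Tendsto A atTop (nhds a) ∧ Tendsto B atTop (nhds b) := by
  have hstep (n : ℕ) := hm.norm_sub_le hlam (n + 1)
  simp only [add_sub_cancel_right] at hstep
  have hN := le_mul_exp_tsum_of_le_one_add_mul (u := fun n : ℕ => ‖A n‖ + ‖B n‖)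
    (w := fun n => |α (n + 1)| / |lam|) (by positivity) (fun n => by positivity)
    (hα.div_const _) fun n => by
      obtain ⟨hA, hB⟩ := hstep n
      have hA' := norm_sub_norm_le (A (n + 1)) (A n)
      have hB' := norm_sub_norm_le (B (n + 1)) (B n)
      have hhalf : |α (n + 1)| / |lam| = 2 * (|α (n + 1)| / (2 * |lam|)) := by field_simp
      push_cast
      rw [hhalf]
      linarith
  set C := Real.exp (∑' n : ℕ, |α (n + 1)| / |lam|) * (‖A (0 : ℕ)‖ + ‖B (0 : ℕ)‖)
  have hd : Summable fun n : ℕ => |α (n + 1)| / (2 * |lam|) * C :=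
    (hα.div_const _).mul_right _
  have hle (n : ℕ) : |α (n + 1)| / (2 * |lam|) * (‖A n‖ + ‖B n‖) ≤
      |α (n + 1)| / (2 * |lam|) * C := by
    gcongr
    exact hN n
  obtain ⟨a, ha⟩ := exists_tendsto_of_norm_sub_le hd fun n => (hstep n).1.trans (hle n)
  obtain ⟨b, hb⟩ := exists_tendsto_of_norm_sub_le hd fun n => (hstep n).2.trans (hle n)
  exact ⟨a, b, ha, hb⟩

/-- If `α ∈ ℓ^{1,1}(ℤ)`, `λ ∈ ℝ ∖ {0}` and `(A⁻,B⁻)` satisfies the matching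
conditions with `(A⁻_j, B⁻_j) → (0,1)` as `j → −∞`, then the limits
`a(λ) = lim_{j→+∞} A⁻_j` and `b(λ) = lim_{j→+∞} B⁻_j` exist and satisfy
`|b(λ)|² = 1 + |a(λ)|²`. -/
theorem statement9 (α : ℤ → ℝ) (hα : Summable fun j : ℤ => |(j : ℝ)| * |α j|)
    (lam : ℝ) (hlam : lam ≠ 0) (Am Bm : ℤ → ℂ)
    (hm : Matching α (lam : ℂ) Am Bm)
    (hAm : Tendsto Am atBot (nhds 0)) (hBm : Tendsto Bm atBot (nhds 1)) :
    ∃ a b : ℂ, Tendsto Am atTop (nhds a) ∧ Tendsto Bm atTop (nhds b) ∧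
      ‖b‖ ^ 2 = 1 + ‖a‖ ^ 2 := by
  have hs : Summable fun n : ℕ => |α (n + 1)| := by
    have hinj : Function.Injective fun n : ℕ => (n : ℤ) + 1 := fun m n h => by simpa using h
    refine (hα.comp_injective hinj).of_nonneg_of_le (fun n => abs_nonneg _) fun n => ?_
    refine le_mul_of_one_le_left (abs_nonneg _) ?_
    push_cast
    rw [abs_of_nonneg (by positivity)]
    linarith [n.cast_nonneg (α := ℝ)]
  obtain ⟨a, b, ha, hb⟩ := hm.exists_tendsto_atTop hlam hs
  refine ⟨a, b, ha, hb, ?_⟩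
  have hconst := hm.norm_sq_sub_norm_sq_eq hlam
  have hbot := (hBm.norm.pow 2).sub (hAm.norm.pow 2)
  have htop := (hb.norm.pow 2).sub (ha.norm.pow 2)
  simp only [hconst] at hbot htop
  have h1 := tendsto_nhds_unique hbot tendsto_const_nhds
  have h2 := tendsto_nhds_unique htop tendsto_const_nhds
  simp only [norm_one, norm_zero] at h1
  linarith
end

section
/- Assume α ∈ ℓ^{1,1}(ℤ). There exists a constant C > 0, depending only on α, such that for all λ ∈ ℂ⁺ and all s ∈ ℝ: |m_+(λ, s)| ≤ C (1 + max(−s, 0)) and |m_−(λ, s)| ≤ C (1 + max(s, 0)). -/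
open Complex Filter

/-- The summand of the series defining `m_+(λ,x)`, indexed by an increasing tuple
`j : Fin (n+1) → ℤ` (with the convention `j₀ = x`):
`∏_{l} α_{j_l} (e^{2iλ(j_l − j_{l−1})} − 1)/(2iλ)`. -/
noncomputable def jostTermP (α : ℤ → ℝ) (lam : ℂ) (x : ℝ) {n : ℕ} (j : Fin (n + 1) → ℤ) : ℂ :=
  ∏ l : Fin (n + 1),
    (α (j l) : ℂ) *
      ((Complex.exp (2 * Complex.I * lam *
          ((j l : ℂ) - (Fin.cons (x : ℂ) (fun k : Fin n => ((j k.castSucc : ℤ) : ℂ)) : Fin (n + 1) → ℂ) l)) - 1) /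
        (2 * Complex.I * lam))

/-- The index set for `m_+(λ,x)`: strictly increasing integer tuples above `x`. -/
def jostIdxP (x : ℝ) (n : ℕ) : Type :=
  {j : Fin (n + 1) → ℤ // StrictMono j ∧ x < ((j 0 : ℤ) : ℝ)}

/-- `m_+(λ, x) = 1 + Σ_{n≥1} Σ_{x<j₁<⋯<j_n} ∏_l α_{j_l} (e^{2iλ(j_l−j_{l−1})}−1)/(2iλ)`. -/
noncomputable def mPlus (α : ℤ → ℝ) (lam : ℂ) (x : ℝ) : ℂ :=
  1 + ∑' (n : ℕ) (j : jostIdxP x n), jostTermP α lam x j.1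

/-- The summand of the series defining `m_−(λ,x)`, indexed by a decreasing tuple
`j : Fin (n+1) → ℤ` (with the convention `j₀ = x`):
`∏_{l} α_{j_l} (e^{−2iλ(j_l − j_{l−1})} − 1)/(2iλ)`. -/
noncomputable def jostTermM (α : ℤ → ℝ) (lam : ℂ) (x : ℝ) {n : ℕ} (j : Fin (n + 1) → ℤ) : ℂ :=
  ∏ l : Fin (n + 1),
    (α (j l) : ℂ) *
      ((Complex.exp (-(2 * Complex.I * lam) *
          ((j l : ℂ) - (Fin.cons (x : ℂ) (fun k : Fin n => ((j k.castSucc : ℤ) : ℂ)) : Fin (n + 1) → ℂ) l)) - 1) /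
        (2 * Complex.I * lam))

/-- The index set for `m_−(λ,x)`: strictly decreasing integer tuples below `x`. -/
def jostIdxM (x : ℝ) (n : ℕ) : Type :=
  {j : Fin (n + 1) → ℤ // StrictAnti j ∧ ((j 0 : ℤ) : ℝ) < x}

/-- `m_−(λ, x) = 1 + Σ_{n≥1} Σ_{j_n<⋯<j₁<x} ∏_l α_{j_l} (e^{−2iλ(j_l−j_{l−1})}−1)/(2iλ)`. -/
noncomputable def mMinus (α : ℤ → ℝ) (lam : ℂ) (x : ℝ) : ℂ :=
  1 + ∑' (n : ℕ) (j : jostIdxM x n), jostTermM α lam x j.1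

lemma norm_exp_sub_one_le_of_re_nonpos {z : ℂ} (hz : z.re ≤ 0) : ‖exp z - 1‖ ≤ ‖z‖ := by
  have h := (convex_halfSpace_re_le 0).norm_image_sub_le_of_norm_deriv_le (𝕜 := ℂ) (f := exp)
    (C := 1) (x := 0) (y := z) (fun w _ => differentiableAt_exp)
    (fun w hw => by
      rw [Complex.deriv_exp, norm_exp]
      exact Real.exp_le_one_iff.2 hw)
    (by simp) hz
  simpa using h

lemma norm_exp_mul_sub_one_div_le {lam : ℂ} (hlam : 0 < lam.im) {d : ℝ} (hd : 0 ≤ d) :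
    ‖(exp (2 * I * lam * d) - 1) / (2 * I * lam)‖ ≤ d := by
  have hlam0 : lam ≠ 0 := by
    rintro rfl
    simp at hlam
  have hne : 2 * I * lam ≠ 0 := mul_ne_zero (mul_ne_zero two_ne_zero I_ne_zero) hlam0
  have hre : (2 * I * lam * d).re ≤ 0 := by
    have : (2 * I * lam * d).re = -(2 * (lam.im * d)) := by
      simp
      ring
    rw [this]
    have := mul_nonneg hlam.le hd
    linarith
  rw [norm_div, div_le_iff₀ (norm_pos_iff.2 hne)]
  calc ‖exp (2 * I * lam * d) - 1‖ ≤ ‖2 * I * lam * d‖ := norm_exp_sub_one_le_of_re_nonpos hre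
    _ = d * ‖2 * I * lam‖ := by rw [norm_mul _ (d : ℂ), norm_real,
        Real.norm_of_nonneg hd, mul_comm]

/-- Each increment `b - a` is split into a factor depending on `a` and one depending on `b`, so
that along a path the factors can be regrouped by node. -/
lemma sub_le_one_add_negPart_mul (a b : ℝ) :
    b - a ≤ (1 + max (-a) 0) * (1 + max b 0) := by
  have h1 := le_max_left (-a) 0
  have h2 := le_max_left b 0
  have h3 := mul_nonneg (le_max_right (-a) 0) (le_max_right b 0)
  linarith

lemma one_add_negPart_mul_one_add_posPart (a : ℝ) :
    (1 + max (-a) 0) * (1 + max a 0) = 1 + |a| := by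
  rcases le_total 0 a with h | h
  · simp [h, abs_of_nonneg h]
  · simp [h, abs_of_nonpos h]

lemma prod_sub_prev_le (x : ℝ) {n : ℕ} (y : Fin (n + 1) → ℝ)
    (hy : ∀ l, (Fin.cons x (fun k : Fin n => y k.castSucc) : Fin (n + 1) → ℝ) l ≤ y l) :
    ∏ l, (y l - (Fin.cons x (fun k : Fin n => y k.castSucc) : Fin (n + 1) → ℝ) l) ≤
      (1 + max (-x) 0) * ∏ l, (1 + |y l|) := by
  have pos (a : ℝ) : 0 ≤ 1 + max a 0 := by positivity
  calc
    _ ≤ ∏ l, (1 + max (-(Fin.cons x (fun k : Fin n => y k.castSucc) : Fin (n + 1) → ℝ) l) 0) *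
          (1 + max (y l) 0) :=
        Finset.prod_le_prod (fun l _ => sub_nonneg.2 (hy l))
          fun l _ => sub_le_one_add_negPart_mul _ _
    _ = (1 + max (-x) 0) *
          ((∏ k : Fin n, (1 + max (-y k.castSucc) 0)) * ∏ l, (1 + max (y l) 0)) := by
        rw [Finset.prod_mul_distrib, Fin.prod_univ_succ]
        simp [mul_assoc]
    _ ≤ (1 + max (-x) 0) *
          ((∏ l, (1 + max (-y l) 0)) * ∏ l, (1 + max (y l) 0)) := by
        refine mul_le_mul_of_nonneg_left (mul_le_mul_of_nonneg_right ?_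
          (Finset.prod_nonneg fun l _ => pos _)) (pos _)
        rw [Fin.prod_univ_castSucc]
        exact le_mul_of_one_le_right (Finset.prod_nonneg fun l _ => pos _) (by simp)
    _ = _ := by
        simp_rw [← Finset.prod_mul_distrib, one_add_negPart_mul_one_add_posPart]

lemma norm_jostTermP_le (α : ℤ → ℝ) {lam : ℂ} (hlam : 0 < lam.im) (x : ℝ) {n : ℕ}
    {j : Fin (n + 1) → ℤ} (hj : StrictMono j) (hx : x < j 0) :
    ‖jostTermP α lam x j‖ ≤ (1 + max (-x) 0) * ∏ l, (1 + |(j l : ℝ)|) * |α (j l)| := by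
  set p : Fin (n + 1) → ℝ := Fin.cons x (fun k : Fin n => (j k.castSucc : ℝ)) with hp
  have hle (l) : p l ≤ j l := by
    refine Fin.cases ?_ (fun k => ?_) l
    · simpa [hp] using hx.le
    · simpa [hp] using (hj k.castSucc_lt_succ).le
  have hcast (l) : (Fin.cons (x : ℂ) (fun k : Fin n => ((j k.castSucc : ℤ) : ℂ)) :
      Fin (n + 1) → ℂ) l = (p l : ℂ) := by
    refine Fin.cases ?_ (fun k => ?_) l <;> simp [hp]
  calc ‖jostTermP α lam x j‖ ≤ ∏ l, |α (j l)| * (j l - p l) := by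
        rw [jostTermP, norm_prod]
        refine Finset.prod_le_prod (fun l _ => norm_nonneg _) fun l _ => ?_
        rw [norm_mul, norm_real, Real.norm_eq_abs, hcast]
        refine mul_le_mul_of_nonneg_left ?_ (abs_nonneg _)
        simpa using norm_exp_mul_sub_one_div_le hlam (sub_nonneg.2 (hle l))
    _ = (∏ l, (j l - p l)) * ∏ l, |α (j l)| := by
        rw [Finset.prod_mul_distrib, mul_comm]
    _ ≤ ((1 + max (-x) 0) * ∏ l, (1 + |(j l : ℝ)|)) * ∏ l, |α (j l)| :=
        mul_le_mul_of_nonneg_right (prod_sub_prev_le x (fun l => (j l : ℝ)) hle)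
          (Finset.prod_nonneg fun l _ => abs_nonneg _)
    _ = _ := by rw [Finset.prod_mul_distrib, mul_assoc]

/-- The set of entries of a strictly increasing tuple of arbitrary length. -/
def jostIdxP.toFinset {x : ℝ} (p : Σ n, jostIdxP x n) : Finset ℤ :=
  Finset.univ.map ⟨p.2.1, p.2.2.1.injective⟩

lemma jostIdxP.toFinset_injective (x : ℝ) :
    Function.Injective (jostIdxP.toFinset (x := x)) := by
  rintro ⟨n, j, hj⟩ ⟨m, k, hk⟩ h
  have hcard := congrArg Finset.card h
  simp only [jostIdxP.toFinset, Finset.card_map, Finset.card_univ, Fintype.card_fin,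
    add_left_inj] at hcard
  subst hcard
  have hrange : Set.range j = Set.range k := by
    simpa [jostIdxP.toFinset] using congrArg (fun s : Finset ℤ => (s : Set ℤ)) h
  obtain rfl : j = k := (hj.1.range_inj hk.1).1 hrange
  rfl

lemma norm_mPlus_le {α : ℤ → ℝ} (hα : Summable fun j : ℤ => (1 + |(j : ℝ)|) * |α j|) {lam : ℂ}
    (hlam : 0 < lam.im) (x : ℝ) :
    ‖mPlus α lam x‖ ≤
      (1 + ∑' s : Finset ℤ, ∏ j ∈ s, (1 + |(j : ℝ)|) * |α j|) * (1 + max (-x) 0) := by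
  set w : Finset ℤ → ℝ := fun s => ∏ j ∈ s, (1 + |(j : ℝ)|) * |α j|
  have hw0 (s) : 0 ≤ w s := Finset.prod_nonneg fun j _ => by positivity
  have hw : Summable w := summable_finsetProd_of_summable_nonneg (fun j => by positivity) hα
  have hwi : Summable (w ∘ jostIdxP.toFinset (x := x)) :=
    hw.comp_injective (jostIdxP.toFinset_injective x)
  have hbound (p : Σ n, jostIdxP x n) :
      ‖jostTermP α lam x p.2.1‖ ≤ (1 + max (-x) 0) * w (jostIdxP.toFinset p) := by
    simpa [w, jostIdxP.toFinset] using norm_jostTermP_le α hlam x p.2.2.1 p.2.2.2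
  have hsum : Summable fun p : Σ n, jostIdxP x n => jostTermP α lam x p.2.1 :=
    .of_norm_bounded (hwi.mul_left _) hbound
  have hseries : ‖∑' p : Σ n, jostIdxP x n, jostTermP α lam x p.2.1‖ ≤
      (1 + max (-x) 0) * ∑' s, w s :=
    (tsum_of_norm_bounded (hwi.mul_left (1 + max (-x) 0)).hasSum hbound).trans <| by
      rw [tsum_mul_left]
      exact mul_le_mul_of_nonneg_left
        (hwi.tsum_le_tsum_of_inj _ (jostIdxP.toFinset_injective x) (fun s _ => hw0 s)
          (fun _ => le_rfl) hw) (by positivity)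
  calc ‖mPlus α lam x‖ ≤ 1 + (1 + max (-x) 0) * ∑' s, w s := by
        rw [mPlus, ← hsum.tsum_sigma]
        exact (norm_add_le _ _).trans (by simpa using hseries)
    _ ≤ _ := by
        have := le_max_right (-x) 0
        linarith

/-- Negating a tuple exchanges the index sets of `m_-` at `x` and `m_+` at `-x`. -/
def jostIdxM.negEquiv (x : ℝ) (n : ℕ) : jostIdxM x n ≃ jostIdxP (-x) n where
  toFun j := ⟨fun l => -j.1 l, fun _ _ h => neg_lt_neg (j.2.1 h), by
    simpa using j.2.2⟩
  invFun j := ⟨fun l => -j.1 l, fun _ _ h => neg_lt_neg (j.2.1 h), by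
    simpa using neg_lt.1 j.2.2⟩
  left_inv j := Subtype.ext (funext fun l => neg_neg (j.1 l))
  right_inv j := Subtype.ext (funext fun l => neg_neg (j.1 l))

lemma jostTermM_eq_jostTermP_neg (α : ℤ → ℝ) (lam : ℂ) (x : ℝ) {n : ℕ} (j : Fin (n + 1) → ℤ) :
    jostTermM α lam x j = jostTermP (fun i => α (-i)) lam (-x) (fun l => -j l) := by
  refine Finset.prod_congr rfl fun l _ => ?_
  have hprev : (Fin.cons ((-x : ℝ) : ℂ) (fun k : Fin n => ((-j k.castSucc : ℤ) : ℂ)) :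
      Fin (n + 1) → ℂ) l =
      -(Fin.cons (x : ℂ) (fun k : Fin n => ((j k.castSucc : ℤ) : ℂ)) : Fin (n + 1) → ℂ) l := by
    refine Fin.cases ?_ (fun k => ?_) l <;> simp
  have harg (a b : ℂ) : -(2 * I * lam) * (a - b) = 2 * I * lam * (-a - -b) := by ring
  rw [hprev, harg]
  simp only [neg_neg, Int.cast_neg]

lemma mMinus_eq_mPlus_neg (α : ℤ → ℝ) (lam : ℂ) (x : ℝ) :
    mMinus α lam x = mPlus (fun i => α (-i)) lam (-x) := by
  unfold mMinus mPlus
  congr 2 with n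
  rw [← (jostIdxM.negEquiv x n).tsum_eq]
  exact tsum_congr fun j => jostTermM_eq_jostTermP_neg α lam x j.1

lemma summable_one_add_abs_mul {α : ℤ → ℝ} (hα : Summable fun j : ℤ => |(j : ℝ)| * |α j|) :
    Summable fun j : ℤ => (1 + |(j : ℝ)|) * |α j| := by
  refine .of_norm_bounded_eventually (hα.mul_left 2) ?_
  filter_upwards [(Set.finite_singleton (0 : ℤ)).compl_mem_cofinite] with j hj
  have h1 : (1 : ℝ) ≤ |(j : ℝ)| := by exact_mod_cast Int.one_le_abs hj
  rw [Real.norm_of_nonneg (by positivity), ← mul_assoc]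
  exact mul_le_mul_of_nonneg_right (by linarith) (abs_nonneg _)

/-- For `α ∈ ℓ^{1,1}(ℤ)` there is `C > 0` (depending only on `α`) with
`|m_+(λ,s)| ≤ C (1 + max(−s,0))` and `|m_−(λ,s)| ≤ C (1 + max(s,0))` for all
`λ ∈ ℂ⁺` and `s ∈ ℝ`. -/
theorem statement13 (α : ℤ → ℝ) (hα : Summable fun j : ℤ => |(j : ℝ)| * |α j|) :
    ∃ C : ℝ, 0 < C ∧ ∀ lam : ℂ, 0 < lam.im → ∀ s : ℝ,
      ‖mPlus α lam s‖ ≤ C * (1 + max (-s) 0) ∧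
      ‖mMinus α lam s‖ ≤ C * (1 + max s 0) := by
  have hα' : Summable fun j : ℤ => |(j : ℝ)| * |α (-j)| := by
    simpa [Function.comp_def] using hα.comp_injective neg_injective
  have hP := summable_one_add_abs_mul hα
  have hM := summable_one_add_abs_mul hα'
  set A := ∑' s : Finset ℤ, ∏ j ∈ s, (1 + |(j : ℝ)|) * |α j|
  set B := ∑' s : Finset ℤ, ∏ j ∈ s, (1 + |(j : ℝ)|) * |α (-j)|
  have hA : 0 ≤ A := tsum_nonneg fun s => Finset.prod_nonneg fun j _ => by positivity
  have hB : 0 ≤ B := tsum_nonneg fun s => Finset.prod_nonneg fun j _ => by positivity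
  refine ⟨1 + A + B, by positivity, fun lam hlam s => ⟨?_, ?_⟩⟩
  · exact (norm_mPlus_le hP hlam s).trans
      (mul_le_mul_of_nonneg_right (by linarith) (by positivity))
  · rw [mMinus_eq_mPlus_neg]
    refine (norm_mPlus_le hM hlam (-s)).trans ?_
    rw [neg_neg]
    exact mul_le_mul_of_nonneg_right (by linarith) (by positivity)
end

section
/- Assume α ∈ ℓ^{1,2}(ℤ). There exists a constant C > 0, depending only on α, such that for all λ ∈ ℂ⁺ and all s ∈ ℝ: |∂_λ m_+(λ, s)| ≤ C (1 − s · max(−s, 0)) and |∂_λ m_−(λ, s)| ≤ C (1 + s · max(s, 0)), where ∂_λ denotes the complex derivative of the holomorphic maps λ ↦ m_±(λ, s) on ℂ⁺. -/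
open Complex Filter

lemma norm_exp_sub_exp_le_of_re_nonpos {a b : ℂ} (ha : a.re ≤ 0) (hb : b.re ≤ 0) :
    ‖Complex.exp a - Complex.exp b‖ ≤ ‖a - b‖ := by
  have h := (convex_halfSpace_re_le 0).norm_image_sub_le_of_norm_hasDerivWithin_le
    (f := Complex.exp) (f' := Complex.exp) (C := 1)
    (fun z _ => (Complex.hasDerivAt_exp z).hasDerivWithinAt)
    (fun z hz => by
      rw [Complex.norm_exp]
      exact Real.exp_le_one_iff.2 hz) hb ha
  simpa using h

/-- The kernel `(e^{2iλd} − 1)/(2iλ)` of the series defining `m_±`. -/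
noncomputable def jostKernel (z : ℂ) (d : ℝ) : ℂ :=
  (Complex.exp (2 * Complex.I * z * d) - 1) / (2 * Complex.I * z)

lemma two_I_mul_ne_zero {z : ℂ} (hz : 0 < z.im) : 2 * Complex.I * z ≠ 0 := by
  have : z ≠ 0 := by
    rintro rfl
    simp at hz
  simp [this]

lemma re_two_I_mul_nonpos {z : ℂ} (hz : 0 < z.im) {d : ℝ} (hd : 0 ≤ d) :
    (2 * Complex.I * z * d).re ≤ 0 := by
  have : (2 * Complex.I * z * d).re = -(2 * z.im * d) := by simp
  rw [this]
  have := mul_nonneg hz.le hd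
  linarith

lemma norm_jostKernel_le {z : ℂ} (hz : 0 < z.im) {d : ℝ} (hd : 0 ≤ d) :
    ‖jostKernel z d‖ ≤ d := by
  have hne := two_I_mul_ne_zero hz
  have h := norm_exp_sub_exp_le_of_re_nonpos (re_two_I_mul_nonpos hz hd)
    (b := 0) (by simp)
  rw [Complex.exp_zero, sub_zero, norm_mul, Complex.norm_real, Real.norm_of_nonneg hd] at h
  rw [jostKernel, norm_div, div_le_iff₀ (norm_pos_iff.2 hne), mul_comm d]
  exact h

lemma jostKernel_eq_integral {z : ℂ} (hz : 0 < z.im) (d : ℝ) :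
    jostKernel z d = ∫ t in (0 : ℝ)..d, Complex.exp (2 * Complex.I * z * t) := by
  rw [integral_exp_mul_complex (two_I_mul_ne_zero hz)]
  simp [jostKernel]

lemma norm_jostKernel_sub_le {z w : ℂ} (hz : 0 < z.im) (hw : 0 < w.im) {d : ℝ} (hd : 0 ≤ d) :
    ‖jostKernel z d - jostKernel w d‖ ≤ 2 * ‖z - w‖ * d ^ 2 := by
  have hint : ∀ v : ℂ, IntervalIntegrable (fun t : ℝ => Complex.exp (2 * Complex.I * v * t))
      MeasureTheory.volume 0 d := fun v =>
    (by fun_prop : Continuous fun t : ℝ => Complex.exp (2 * Complex.I * v * t)).intervalIntegrable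
      _ _
  rw [jostKernel_eq_integral hz, jostKernel_eq_integral hw,
    ← intervalIntegral.integral_sub (hint z) (hint w)]
  have h := intervalIntegral.norm_integral_le_of_norm_le_const (a := 0) (b := d)
    (C := 2 * ‖z - w‖ * d)
    (f := fun t : ℝ => Complex.exp (2 * Complex.I * z * t) - Complex.exp (2 * Complex.I * w * t))
    (fun t ht => by
      rw [Set.uIoc_of_le hd] at ht
      refine (norm_exp_sub_exp_le_of_re_nonpos (re_two_I_mul_nonpos hz ht.1.le)
        (re_two_I_mul_nonpos hw ht.1.le)).trans ?_
      have : 2 * Complex.I * z * t - 2 * Complex.I * w * t = 2 * Complex.I * (z - w) * t := by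
        ring
      rw [this, norm_mul, norm_mul, norm_mul, Complex.norm_real, Real.norm_of_nonneg ht.1.le]
      simp only [Complex.norm_ofNat, Complex.norm_I, mul_one]
      gcongr
      exact ht.2)
  rw [sub_zero, abs_of_nonneg hd] at h
  linarith

lemma norm_prod_sub_prod_le_card_mul {ι : Type*} (s : Finset ι) {a b : ι → ℂ} {c : ι → ℝ} {δ : ℝ}
    (ha : ∀ i ∈ s, ‖a i‖ ≤ c i) (hb : ∀ i ∈ s, ‖b i‖ ≤ c i)
    (hab : ∀ i ∈ s, ‖a i - b i‖ ≤ δ * c i) :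
    ‖∏ i ∈ s, a i - ∏ i ∈ s, b i‖ ≤ s.card * δ * ∏ i ∈ s, c i := by
  classical
  induction s using Finset.induction_on with
  | empty => simp
  | insert i s hi ih =>
    rw [Finset.prod_insert hi, Finset.prod_insert hi, Finset.prod_insert hi,
      Finset.card_insert_of_notMem hi]
    have hs := ih (fun k hk => ha k (Finset.mem_insert_of_mem hk))
      (fun k hk => hb k (Finset.mem_insert_of_mem hk))
      (fun k hk => hab k (Finset.mem_insert_of_mem hk))
    have hai := ha i (Finset.mem_insert_self i s)
    have habi := hab i (Finset.mem_insert_self i s)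
    have hbs : ‖∏ k ∈ s, b k‖ ≤ ∏ k ∈ s, c k := by
      rw [norm_prod]
      exact Finset.prod_le_prod (fun _ _ => norm_nonneg _)
        fun k hk => hb k (Finset.mem_insert_of_mem hk)
    calc ‖a i * ∏ k ∈ s, a k - b i * ∏ k ∈ s, b k‖
        = ‖a i * (∏ k ∈ s, a k - ∏ k ∈ s, b k) + (a i - b i) * ∏ k ∈ s, b k‖ := by ring_nf
      _ ≤ ‖a i‖ * ‖∏ k ∈ s, a k - ∏ k ∈ s, b k‖ + ‖a i - b i‖ * ‖∏ k ∈ s, b k‖ := by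
        refine (norm_add_le _ _).trans ?_
        rw [norm_mul, norm_mul]
      _ ≤ c i * (s.card * δ * ∏ k ∈ s, c k) + (δ * c i) * ∏ k ∈ s, c k := by
        have hci : 0 ≤ c i := (norm_nonneg _).trans hai
        have hdi : 0 ≤ δ * c i := (norm_nonneg _).trans habi
        gcongr
      _ = ((s.card + 1 : ℕ) : ℝ) * δ * (c i * ∏ k ∈ s, c k) := by
        push_cast
        ring

/-- The predecessor `j_{l−1}` (with `j₀ = x`) in a tuple. -/
def jostPrev (x : ℝ) {n : ℕ} (j : Fin (n + 1) → ℤ) : Fin (n + 1) → ℝ :=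
  Fin.cons x fun k : Fin n => ((j k.castSucc : ℤ) : ℝ)

lemma jostPrev_le {x : ℝ} {n : ℕ} (j : jostIdxP x n) (l : Fin (n + 1)) :
    jostPrev x j.1 l ≤ (j.1 l : ℝ) := by
  refine Fin.cases ?_ (fun k => ?_) l
  · simpa [jostPrev] using j.2.2.le
  · simpa [jostPrev] using (j.2.1 k.castSucc_lt_succ).le

lemma jostTermP_eq (α : ℤ → ℝ) (z : ℂ) (x : ℝ) {n : ℕ} (j : Fin (n + 1) → ℤ) :
    jostTermP α z x j =
      ∏ l, (α (j l) : ℂ) * jostKernel z ((j l : ℝ) - jostPrev x j l) := by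
  refine Finset.prod_congr rfl fun l _ => ?_
  have : (Fin.cons (x : ℂ) (fun k : Fin n => ((j k.castSucc : ℤ) : ℂ)) : Fin (n + 1) → ℂ) l
      = ((jostPrev x j l : ℝ) : ℂ) := by
    refine Fin.cases ?_ (fun k => ?_) l <;> simp [jostPrev]
  rw [this, jostKernel]
  push_cast
  rfl

/-- The summable weight `(1 + |j|)² |α_j|`. -/
noncomputable def jostWeight (α : ℤ → ℝ) (j : ℤ) : ℝ := (1 + |(j : ℝ)|) ^ 2 * |α j|

lemma jostWeight_nonneg (α : ℤ → ℝ) (j : ℤ) : 0 ≤ jostWeight α j := by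
  unfold jostWeight
  positivity

lemma summable_jostWeight {α : ℤ → ℝ} (hα : Summable fun j : ℤ => (j : ℝ) ^ 2 * |α j|) :
    Summable (jostWeight α) := by
  refine (hα.mul_left 4).of_norm_bounded_eventually ?_
  filter_upwards [(Set.finite_singleton (0 : ℤ)).compl_mem_cofinite] with j hj
  have hj1 : (1 : ℝ) ≤ |(j : ℝ)| := by exact_mod_cast Int.one_le_abs hj
  rw [Real.norm_of_nonneg (jostWeight_nonneg α j), jostWeight, ← mul_assoc, ← sq_abs (j : ℝ)]
  gcongr
  nlinarith

lemma prod_step_sq_le {x : ℝ} {n : ℕ} (α : ℤ → ℝ) (j : Fin (n + 1) → ℤ) :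
    ∏ l, ((1 + max (j l : ℝ) 0) * (1 + max (-jostPrev x j l) 0)) ^ 2 * |α (j l)| ≤
      (1 + max (-x) 0) ^ 2 * ∏ l, jostWeight α (j l) := by
  have hq : ∏ l, (1 + max (-jostPrev x j l) 0) ^ 2 ≤
      (1 + max (-x) 0) ^ 2 * ∏ l, (1 + max (-(j l : ℝ)) 0) ^ 2 := by
    rw [Fin.prod_univ_succ, Fin.prod_univ_castSucc (fun l => (1 + max (-(j l : ℝ)) 0) ^ 2)]
    simp only [jostPrev, Fin.cons_zero, Fin.cons_succ]
    refine mul_le_mul_of_nonneg_left (le_mul_of_one_le_right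
      (Finset.prod_nonneg fun _ _ => sq_nonneg _) (one_le_pow₀ ?_)) (sq_nonneg _)
    linarith [le_max_right (-(j (Fin.last n) : ℝ)) 0]
  have hw : ∀ k : ℤ, jostWeight α k =
      (1 + max (k : ℝ) 0) ^ 2 * (1 + max (-(k : ℝ)) 0) ^ 2 * |α k| := by
    intro k
    rw [jostWeight, ← mul_pow]
    rcases le_total (0 : ℝ) k with h | h
    · rw [abs_of_nonneg h, max_eq_left h, max_eq_right (by linarith)]
      ring
    · rw [abs_of_nonpos h, max_eq_right h, max_eq_left (by linarith)]
      ring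
  simp only [hw, mul_pow, Finset.prod_mul_distrib]
  have h1 : 0 ≤ ∏ l, (1 + max (j l : ℝ) 0) ^ 2 := Finset.prod_nonneg fun _ _ => sq_nonneg _
  have h2 : 0 ≤ ∏ l, |α (j l)| := Finset.prod_nonneg fun _ _ => abs_nonneg _
  calc _ ≤ (∏ l, (1 + max (j l : ℝ) 0) ^ 2) *
        ((1 + max (-x) 0) ^ 2 * ∏ l, (1 + max (-(j l : ℝ)) 0) ^ 2) * ∏ l, |α (j l)| := by gcongr
    _ = _ := by ring

lemma sub_le_mul_one_add_max (a b : ℝ) : a - b ≤ (1 + max a 0) * (1 + max (-b) 0) := by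
  nlinarith [le_max_left a 0, le_max_right a 0, le_max_left (-b) 0, le_max_right (-b) 0,
    mul_nonneg (le_max_right a 0) (le_max_right (-b) 0)]

lemma norm_factor_le (α : ℤ → ℝ) {z : ℂ} (hz : 0 < z.im) {x : ℝ} {n : ℕ} (j : jostIdxP x n)
    (l : Fin (n + 1)) :
    ‖(α (j.1 l) : ℂ) * jostKernel z ((j.1 l : ℝ) - jostPrev x j.1 l)‖ ≤
      ((1 + max (j.1 l : ℝ) 0) * (1 + max (-jostPrev x j.1 l) 0)) ^ 2 * |α (j.1 l)| := by
  rw [norm_mul, Complex.norm_real, Real.norm_eq_abs, mul_comm]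
  refine mul_le_mul_of_nonneg_right ?_ (abs_nonneg _)
  refine (norm_jostKernel_le hz (sub_nonneg.2 (jostPrev_le j l))).trans
    ((sub_le_mul_one_add_max _ _).trans (le_self_pow₀ ?_ two_ne_zero))
  exact one_le_mul_of_one_le_of_one_le (by simp) (by simp)

lemma norm_factor_sub_le (α : ℤ → ℝ) {z w : ℂ} (hz : 0 < z.im) (hw : 0 < w.im) {x : ℝ} {n : ℕ}
    (j : jostIdxP x n) (l : Fin (n + 1)) :
    ‖(α (j.1 l) : ℂ) * jostKernel z ((j.1 l : ℝ) - jostPrev x j.1 l) -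
        (α (j.1 l) : ℂ) * jostKernel w ((j.1 l : ℝ) - jostPrev x j.1 l)‖ ≤
      2 * ‖z - w‖ *
        (((1 + max (j.1 l : ℝ) 0) * (1 + max (-jostPrev x j.1 l) 0)) ^ 2 * |α (j.1 l)|) := by
  rw [← mul_sub, norm_mul, Complex.norm_real, Real.norm_eq_abs, mul_comm, ← mul_assoc]
  refine mul_le_mul_of_nonneg_right ?_ (abs_nonneg _)
  have hd := sub_nonneg.2 (jostPrev_le j l)
  refine (norm_jostKernel_sub_le hz hw hd).trans ?_
  gcongr
  exact sub_le_mul_one_add_max _ _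

lemma norm_jostTermP_le_s14 (α : ℤ → ℝ) {z : ℂ} (hz : 0 < z.im) {x : ℝ} {n : ℕ} (j : jostIdxP x n) :
    ‖jostTermP α z x j.1‖ ≤ (1 + max (-x) 0) ^ 2 * ∏ l, jostWeight α (j.1 l) := by
  rw [jostTermP_eq, norm_prod]
  exact (Finset.prod_le_prod (fun _ _ => norm_nonneg _) fun l _ => norm_factor_le α hz j l).trans
    (prod_step_sq_le α j.1)

lemma norm_jostTermP_sub_le (α : ℤ → ℝ) {z w : ℂ} (hz : 0 < z.im) (hw : 0 < w.im) {x : ℝ} {n : ℕ}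
    (j : jostIdxP x n) :
    ‖jostTermP α z x j.1 - jostTermP α w x j.1‖ ≤
      2 * ‖z - w‖ * (1 + max (-x) 0) ^ 2 * ∏ l, 2 * jostWeight α (j.1 l) := by
  rw [jostTermP_eq, jostTermP_eq]
  refine (norm_prod_sub_prod_le_card_mul _ (fun l _ => norm_factor_le α hz j l)
    (fun l _ => norm_factor_le α hw j l) (fun l _ => norm_factor_sub_le α hz hw j l)).trans ?_
  have hcard : ((Finset.univ : Finset (Fin (n + 1))).card : ℝ) ≤ 2 ^ (n + 1) := by
    rw [Finset.card_fin]
    exact_mod_cast (Nat.lt_two_pow_self).le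
  have hpow : ∏ l, 2 * jostWeight α (j.1 l) = 2 ^ (n + 1) * ∏ l, jostWeight α (j.1 l) := by
    rw [Finset.prod_mul_distrib, Finset.prod_const, Finset.card_fin]
  rw [hpow]
  calc _ ≤ 2 ^ (n + 1) * (2 * ‖z - w‖) *
        ((1 + max (-x) 0) ^ 2 * ∏ l, jostWeight α (j.1 l)) := by
        refine mul_le_mul (by gcongr) (prod_step_sq_le α j.1) ?_ (by positivity)
        exact Finset.prod_nonneg fun _ _ => by positivity
    _ = _ := by ring

/-- The finite set of entries of an increasing tuple. -/
def jostSupport (x : ℝ) (p : Σ n : ℕ, jostIdxP x n) : Finset ℤ :=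
  Finset.univ.map ⟨p.2.1, p.2.2.1.injective⟩

lemma jostSupport_injective (x : ℝ) : Function.Injective (jostSupport x) := by
  rintro ⟨n, j⟩ ⟨m, k⟩ h
  have hc := congrArg Finset.card h
  simp only [jostSupport, Finset.card_map, Finset.card_fin, add_left_inj] at hc
  subst hc
  have hr : Set.range j.1 = Set.range k.1 := by
    have := congrArg (fun s : Finset ℤ => (s : Set ℤ)) h
    simpa [jostSupport] using this
  have : j = k := Subtype.ext ((j.2.1.range_inj k.2.1).1 hr)
  rw [this]

lemma prod_jostSupport {x : ℝ} (g : ℤ → ℝ) (p : Σ n : ℕ, jostIdxP x n) :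
    ∏ i ∈ jostSupport x p, g i = ∏ l, g (p.2.1 l) := by
  simp [jostSupport]

lemma summable_prod_jostIdxP {g : ℤ → ℝ} (hg : Summable g) (hg0 : ∀ i, 0 ≤ g i) (x : ℝ) :
    Summable fun p : Σ n : ℕ, jostIdxP x n => ∏ l, g (p.2.1 l) := by
  have h := (summable_finsetProd_of_summable_nonneg hg0 hg).comp_injective
    (jostSupport_injective x)
  exact h.congr fun p => prod_jostSupport g p

lemma tsum_prod_jostIdxP_le {g : ℤ → ℝ} (hg : Summable g) (hg0 : ∀ i, 0 ≤ g i) (x : ℝ) :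
    ∑' p : Σ n : ℕ, jostIdxP x n, ∏ l, g (p.2.1 l) ≤ ∑' s : Finset ℤ, ∏ i ∈ s, g i := by
  have h := tsum_comp_le_tsum_of_inj (summable_finsetProd_of_summable_nonneg hg0 hg)
    (fun s => Finset.prod_nonneg fun i _ => hg0 i) (jostSupport_injective x)
  refine le_trans (le_of_eq (tsum_congr fun p => ?_)) h
  exact (prod_jostSupport g p).symm

lemma summable_jostTermP {α : ℤ → ℝ} (hα : Summable fun j : ℤ => (j : ℝ) ^ 2 * |α j|) {z : ℂ}
    (hz : 0 < z.im) (x : ℝ) :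
    Summable fun p : Σ n : ℕ, jostIdxP x n => jostTermP α z x p.2.1 :=
  ((summable_prod_jostIdxP (summable_jostWeight hα) (jostWeight_nonneg α) x).mul_left
    ((1 + max (-x) 0) ^ 2)).of_norm_bounded fun p => norm_jostTermP_le_s14 α hz p.2

/-- The total weight of all finite sets of integers. -/
noncomputable def jostConst (α : ℤ → ℝ) : ℝ := ∑' s : Finset ℤ, ∏ i ∈ s, 2 * jostWeight α i

lemma jostConst_nonneg (α : ℤ → ℝ) : 0 ≤ jostConst α :=
  tsum_nonneg fun _ => Finset.prod_nonneg fun i _ =>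
    mul_nonneg zero_le_two (jostWeight_nonneg α i)

lemma norm_mPlus_sub_le {α : ℤ → ℝ} (hα : Summable fun j : ℤ => (j : ℝ) ^ 2 * |α j|) {z w : ℂ}
    (hz : 0 < z.im) (hw : 0 < w.im) (x : ℝ) :
    ‖mPlus α z x - mPlus α w x‖ ≤
      2 * (1 + max (-x) 0) ^ 2 * jostConst α * ‖z - w‖ := by
  have hsz := summable_jostTermP hα hz x
  have hsw := summable_jostTermP hα hw x
  have hg := (summable_jostWeight hα).mul_left 2
  have hg0 : ∀ i, 0 ≤ 2 * jostWeight α i := fun i => mul_nonneg zero_le_two (jostWeight_nonneg α i)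
  rw [mPlus, mPlus, add_sub_add_left_eq_sub, ← hsz.tsum_sigma, ← hsw.tsum_sigma,
    ← hsz.tsum_sub hsw]
  refine (tsum_of_norm_bounded ((summable_prod_jostIdxP hg hg0 x).mul_left
    (2 * ‖z - w‖ * (1 + max (-x) 0) ^ 2)).hasSum
    fun p => norm_jostTermP_sub_le α hz hw p.2).trans ?_
  rw [tsum_mul_left]
  calc _ ≤ 2 * ‖z - w‖ * (1 + max (-x) 0) ^ 2 * jostConst α := by
        gcongr
        exact tsum_prod_jostIdxP_le hg hg0 x
    _ = _ := by ring

lemma norm_deriv_mPlus_le {α : ℤ → ℝ} (hα : Summable fun j : ℤ => (j : ℝ) ^ 2 * |α j|) {z : ℂ}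
    (hz : 0 < z.im) (x : ℝ) :
    ‖deriv (fun z : ℂ => mPlus α z x) z‖ ≤ 4 * jostConst α * (1 - x * max (-x) 0) := by
  have hM := jostConst_nonneg α
  have h : ‖deriv (fun z : ℂ => mPlus α z x) z‖ ≤
      2 * (1 + max (-x) 0) ^ 2 * jostConst α := by
    refine norm_deriv_le_of_lip' (by positivity) ?_
    filter_upwards [(isOpen_lt continuous_const Complex.continuous_im).mem_nhds hz] with w hw
    exact norm_mPlus_sub_le hα hw hz x
  refine h.trans ?_
  have hsq : (1 + max (-x) 0) ^ 2 ≤ 2 * (1 - x * max (-x) 0) := by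
    rcases le_total (-x) 0 with hx | hx
    · rw [max_eq_right hx]
      norm_num
    · rw [max_eq_left hx]
      nlinarith [sq_nonneg (1 + x)]
  nlinarith [mul_le_mul_of_nonneg_right hsq hM]

/-- Reflection of tuples, `j ↦ −j`. -/
def jostIdxReflect (x : ℝ) (n : ℕ) : jostIdxM x n ≃ jostIdxP (-x) n where
  toFun j := ⟨fun l => -j.1 l, fun _ _ h => neg_lt_neg (j.2.1 h), by
    push_cast
    exact neg_lt_neg j.2.2⟩
  invFun j := ⟨fun l => -j.1 l, fun _ _ h => neg_lt_neg (j.2.1 h), by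
    push_cast
    exact neg_lt.1 j.2.2⟩
  left_inv j := Subtype.ext (funext fun l => neg_neg _)
  right_inv j := Subtype.ext (funext fun l => neg_neg _)

lemma jostTermM_eq_reflect (α : ℤ → ℝ) (z : ℂ) (x : ℝ) {n : ℕ} (j : Fin (n + 1) → ℤ) :
    jostTermM α z x j = jostTermP (fun k => α (-k)) z (-x) fun l => -j l := by
  refine Finset.prod_congr rfl fun l _ => ?_
  have : (Fin.cons ((-x : ℝ) : ℂ) (fun k : Fin n => ((-j k.castSucc : ℤ) : ℂ)) :
        Fin (n + 1) → ℂ) l =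
      -(Fin.cons (x : ℂ) (fun k : Fin n => ((j k.castSucc : ℤ) : ℂ)) : Fin (n + 1) → ℂ) l := by
    refine Fin.cases ?_ (fun k => ?_) l <;> simp
  rw [this]
  simp only [neg_neg]
  push_cast
  congr 4
  ring

lemma mMinus_eq_mPlus_reflect (α : ℤ → ℝ) (z : ℂ) (x : ℝ) :
    mMinus α z x = mPlus (fun k => α (-k)) z (-x) := by
  rw [mMinus, mPlus]
  congr 1
  refine tsum_congr fun n => ?_
  rw [← (jostIdxReflect x n).tsum_eq]
  exact tsum_congr fun j => jostTermM_eq_reflect α z x j.1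

/-- For `α ∈ ℓ^{1,2}(ℤ)` there is `C > 0` (depending only on `α`) with
`|∂_λ m_+(λ,s)| ≤ C (1 − s max(−s,0))` and `|∂_λ m_−(λ,s)| ≤ C (1 + s max(s,0))`
for all `λ ∈ ℂ⁺` and `s ∈ ℝ`, where `∂_λ` is the complex derivative. -/
theorem statement14 (α : ℤ → ℝ) (hα : Summable fun j : ℤ => (j : ℝ) ^ 2 * |α j|) :
    ∃ C : ℝ, 0 < C ∧ ∀ lam : ℂ, 0 < lam.im → ∀ s : ℝ,
      ‖deriv (fun z : ℂ => mPlus α z s) lam‖ ≤ C * (1 - s * max (-s) 0) ∧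
      ‖deriv (fun z : ℂ => mMinus α z s) lam‖ ≤ C * (1 + s * max s 0) := by
  have hα' : Summable fun j : ℤ => (j : ℝ) ^ 2 * |α (-j)| := by
    refine ((Equiv.neg ℤ).summable_iff.2 hα).congr fun j => ?_
    simp
  have hM := jostConst_nonneg α
  have hM' := jostConst_nonneg fun k => α (-k)
  refine ⟨4 * (jostConst α + jostConst fun k => α (-k)) + 1, by positivity,
    fun lam hlam s => ⟨?_, ?_⟩⟩
  · refine (norm_deriv_mPlus_le hα hlam s).trans (mul_le_mul_of_nonneg_right (by linarith) ?_)
    rcases le_total (-s) 0 with hs | hs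
    · simp [max_eq_right hs]
    · rw [max_eq_left hs]
      nlinarith
  · simp only [mMinus_eq_mPlus_reflect]
    have h := norm_deriv_mPlus_le hα' hlam (-s)
    rw [neg_neg, neg_mul, sub_neg_eq_add] at h
    refine h.trans (mul_le_mul_of_nonneg_right (by linarith) ?_)
    rcases le_total s 0 with hs | hs
    · simp [max_eq_right hs]
    · rw [max_eq_left hs]
      nlinarith
end
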